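/- arXiv:1912.00453 — 3 statements merged into one kernel-verified Lean document; each statement's English description precedes it below -/
import Mathlib

section
/- Under the staircase hypotheses with k ≥ 3, assume Y is invertible, Y2 is invertible and det Ȳ ≠ 0. Set γ = (det of the minor of Y on rows {1,3,4,…,n} and columns {2,…,n}) / det Ȳ, and v_γ = U(e_2 + γe_1). Then φ_{n+1} = ε_{n+1} · (det Y)^{k−2} · det Y_2 · det[U^{k−2}e_1, U^{k−3}v_γ, U^{k−3}e_1, …, U e_1, e_1], where ε_{n+1} = (−1)^{n(k−2)(k−3)/2} and the displayed k×k matrix has the indicated columns. -/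
open Matrix Finset

noncomputable section

/-- The determinant of the minor of the `ℕ`-indexed (0-based) matrix `Φ` on the 1-based
row/column range `[i, M]`; for `i = M + 1` this is the determinant of the empty matrix, `1`. -/
def sminor {α : Type*} [CommRing α] (Φ : ℕ → ℕ → α) (i M : ℕ) : α :=
  (Matrix.of fun r c : Fin (M + 1 - i) => Φ (i - 1 + (r : ℕ)) (i - 1 + (c : ℕ))).det

/-- Package an `ℕ`-indexed (0-based) family of entries as an `n × n` matrix. -/
def toSq {α : Type*} (n : ℕ) (f : ℕ → ℕ → α) : Matrix (Fin n) (Fin n) α :=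
  Matrix.of fun i j => f (i : ℕ) (j : ℕ)

/-- The core `Φ` of a staircase pair `(X, Y)` of `n × n` matrices with parameters
`a = k + b`; it is an `N × N` matrix, `N = (k-1)*n + b`, given here as a (0-based)
`ℕ`-indexed family of entries.  For `1 ≤ j ≤ k-1` (1-based), the block rows
`(j-1)(n-1)+1 .. j(n-1)` carry `Y_{[2,n]}` in columns `(j-1)n+1 .. jn` and (for `j ≥ 2`)
`X_{[2,n]}` in columns `(j-2)n+1 .. (j-1)n`; the last `a - 1` rows carry `X_{[2,a]}` in
columns `(k-2)n+1 .. (k-1)n` and `Y_{[2,a]}^{[1,b]}` in columns `(k-1)n+1 .. N`. -/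
def stairCore {α : Type*} [Zero α] (n k : ℕ) (Xf Yf : ℕ → ℕ → α) : ℕ → ℕ → α := fun r c =>
  if r < (k - 1) * (n - 1) then
    if r / (n - 1) * n ≤ c ∧ c < r / (n - 1) * n + n then
      Yf (r % (n - 1) + 1) (c - r / (n - 1) * n)
    else if 1 ≤ r / (n - 1) ∧ (r / (n - 1) - 1) * n ≤ c ∧ c < r / (n - 1) * n then
      Xf (r % (n - 1) + 1) (c - (r / (n - 1) - 1) * n)
    else 0
  else
    if (k - 2) * n ≤ c ∧ c < (k - 1) * n then
      Xf (r - (k - 1) * (n - 1) + 1) (c - (k - 2) * n)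
    else if (k - 1) * n ≤ c then
      Yf (r - (k - 1) * (n - 1) + 1) (c - (k - 1) * n)
    else 0

/-- `det Ȳ`: determinant of the submatrix of `Y` on rows and columns `2..n` (1-based). -/
def detYbar {α : Type*} [CommRing α] (n : ℕ) (Yf : ℕ → ℕ → α) : α :=
  (Matrix.of fun i j : Fin (n - 1) => Yf ((i : ℕ) + 1) ((j : ℕ) + 1)).det

/-- Determinant of the minor of `Y` on rows `{1, 3, 4, …, n}` and columns `{2, …, n}`
(1-based). -/
def detYgamma {α : Type*} [CommRing α] (n : ℕ) (Yf : ℕ → ℕ → α) : α :=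
  (Matrix.of fun i j : Fin (n - 1) =>
    Yf (if (i : ℕ) = 0 then 0 else (i : ℕ) + 1) ((j : ℕ) + 1)).det

/-- `det (λ Y + μ X)` as a polynomial in the two variables `λ = X 0`, `μ = X 1`. -/
def detLM {α : Type*} [CommRing α] (n : ℕ) (Xf Yf : ℕ → ℕ → α) :
    MvPolynomial (Fin 2) α :=
  Matrix.det
    (((MvPolynomial.X 0 : MvPolynomial (Fin 2) α) • (toSq n Yf).map (fun p => MvPolynomial.C p)
      + (MvPolynomial.X 1 : MvPolynomial (Fin 2) α) • (toSq n Xf).map (fun p => MvPolynomial.C p)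
      : Matrix (Fin n) (Fin n) (MvPolynomial (Fin 2) α)))

/-- The block `Y2`: submatrix of `Y` on rows `k+1 .. k+b` and columns `1 .. b` (1-based). -/
def blockY2 (n k b : ℕ) (h : k + b ≤ n) (Y : Matrix (Fin n) (Fin n) ℂ) :
    Matrix (Fin b) (Fin b) ℂ :=
  Matrix.of fun i j => Y ⟨k + (i : ℕ), by have := i.isLt; omega⟩ (Fin.castLE (by omega) j)

/-- The `k × k` matrix `U = W11 - Y1 Y2⁻¹ W21` attached to a staircase pair `(X, Y)`,
where `[[W11, W12], [W21, W22]]` is the `a × a` leading block of `X Y⁻¹` (`W11` of size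
`k × k`) and `[Y1; Y2]` is the submatrix of `Y` on rows `1..a`, columns `1..b`. -/
def blockU (n k b : ℕ) (h : k + b ≤ n) (X Y : Matrix (Fin n) (Fin n) ℂ) :
    Matrix (Fin k) (Fin k) ℂ :=
  (Matrix.of fun i j : Fin k =>
      (X * Y⁻¹) (Fin.castLE (by omega) i) (Fin.castLE (by omega) j))
    - (Matrix.of fun (i : Fin k) (j : Fin b) =>
          Y (Fin.castLE (by omega) i) (Fin.castLE (by omega) j))
      * (blockY2 n k b h Y)⁻¹
      * (Matrix.of fun (i : Fin b) (j : Fin k) =>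
          (X * Y⁻¹) ⟨k + (i : ℕ), by have := i.isLt; omega⟩ (Fin.castLE (by omega) j))

/-- The standard basis vector `e_{m+1}` (so `basisVec k 0 = e_1`, `basisVec k 1 = e_2`). -/
def basisVec (k m : ℕ) : Fin k → ℂ := fun i => if (i : ℕ) = m then 1 else 0

/-- The vector `v_γ = U (e_2 + γ e_1)`, with `γ` the ratio of the minor of `Y` on rows
`{1,3,…,n}`, columns `{2,…,n}` by `det Ȳ`. -/
def vGamma (n k b : ℕ) (h : k + b ≤ n) (X Y : ℕ → ℕ → ℂ) : Fin k → ℂ :=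
  (blockU n k b h (toSq n X) (toSq n Y)).mulVec
    (basisVec k 1 + (detYgamma n Y / detYbar n Y) • basisVec k 0)

/-- The coefficient ring for the generic staircase pair: polynomials over `ℂ` in the
variables `x_{ij}` (tagged `true`) and `y_{ij}` (tagged `false`). -/
abbrev Rgen : Type := MvPolynomial (Bool × ℕ × ℕ) ℂ

/-- The generic staircase matrix `X` (0-based): `x_{ij}` for `i < a`, `b ≤ j < n`, else `0`. -/
def genX (n a b : ℕ) : ℕ → ℕ → Rgen := fun i j =>
  if i < a ∧ b ≤ j ∧ j < n then MvPolynomial.X (true, i, j) else 0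

/-- The generic staircase matrix `Y` (0-based): `y_{ij}` except in the zero block
(`i ≥ a`, `j < b`). -/
def genY (n a b : ℕ) : ℕ → ℕ → Rgen := fun i j =>
  if i < n ∧ j < n ∧ ¬(a ≤ i ∧ j < b) then MvPolynomial.X (false, i, j) else 0

/-- The coefficient ring for the generic band pair: polynomials over `ℂ` in variables
`a_{ij}`. -/
abbrev Rband : Type := MvPolynomial (ℕ × ℕ) ℂ

/-- The generic band entries `a_{ij}` (1-based). -/
def genA : ℕ → ℕ → Rband := fun i j => MvPolynomial.X (i, j)

/-- The band matrix `X` (0-based indices) built from the entries `a_{ij}` (1-based):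
`X_{i, n-k+i-1+s} = a_{s,i}` for `1 ≤ i ≤ k`, `1 ≤ s ≤ k+1-i` (1-based). -/
def bandX {α : Type*} [Zero α] (n k : ℕ) (a : ℕ → ℕ → α) : ℕ → ℕ → α := fun i j =>
  if i < k ∧ n - k + i ≤ j ∧ j < n then a (j + k + 1 - n - i) (i + 1) else 0

/-- The band matrix `Y` (0-based indices) built from the entries `a_{ij}` (1-based):
`Y_{ij} = a_{k+1-i+j, i}` for `max(1, i-k) ≤ j ≤ i` (1-based), `0` otherwise. -/
def bandY {α : Type*} [Zero α] (n k : ℕ) (a : ℕ → ℕ → α) : ℕ → ℕ → α := fun i j =>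
  if j ≤ i ∧ i ≤ j + k ∧ i < n then a (k + 1 + j - i) (i + 1) else 0

/-- Top-left `k × k` block of `X * Y⁻¹`. -/
def bandUblock (n k : ℕ) (h : k ≤ n) (Xm Ym : Matrix (Fin n) (Fin n) ℂ) :
    Matrix (Fin k) (Fin k) ℂ :=
  Matrix.of fun i j => (Xm * Ym⁻¹) (Fin.castLE h i) (Fin.castLE h j)

/-- `K(A;u) = [u, Au, …, A^{k-1}u]`. -/
def Kmat (k : ℕ) (A : Matrix (Fin k) (Fin k) ℂ) (u : Fin k → ℂ) :
    Matrix (Fin k) (Fin k) ℂ :=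
  Matrix.of fun i j => (A ^ (j : ℕ)).mulVec u i

/-- `K1(A;u,v) = [v, u, Au, …, A^{k-2}u]`. -/
def K1mat (k : ℕ) (A : Matrix (Fin k) (Fin k) ℂ) (u v : Fin k → ℂ) :
    Matrix (Fin k) (Fin k) ℂ :=
  Matrix.of fun i j => if (j : ℕ) = 0 then v i else (A ^ ((j : ℕ) - 1)).mulVec u i

/-- `K2(A;u,v) = [Av, u, Au, …, A^{k-2}u]`. -/
def K2mat (k : ℕ) (A : Matrix (Fin k) (Fin k) ℂ) (u v : Fin k → ℂ) :
    Matrix (Fin k) (Fin k) ℂ :=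
  Matrix.of fun i j => if (j : ℕ) = 0 then A.mulVec v i else (A ^ ((j : ℕ) - 1)).mulVec u i

/-- `w`: the last row of the classical adjoint of `K1(A;u,v)`. -/
def wRow (k : ℕ) (A : Matrix (Fin k) (Fin k) ℂ) (u v : Fin k → ℂ) : Fin k → ℂ :=
  fun j => (K1mat k A u v).adjugate ⟨k - 1, by have := j.isLt; omega⟩ j

/-- `K*(A;u,v)`: the matrix with rows `w, wA, …, wA^{k-1}`. -/
def Kstar (k : ℕ) (A : Matrix (Fin k) (Fin k) ℂ) (u v : Fin k → ℂ) :
    Matrix (Fin k) (Fin k) ℂ :=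
  Matrix.of fun i j => Matrix.vecMul (wRow k A u v) (A ^ (i : ℕ)) j

/-- Extend a `k × k` matrix by zero to an `ℕ`-indexed family of entries. -/
def extMat {α : Type*} [Zero α] (k : ℕ) (M : Matrix (Fin k) (Fin k) α) : ℕ → ℕ → α :=
  fun i j => if h : i < k ∧ j < k then M ⟨i, h.1⟩ ⟨j, h.2⟩ else 0

/-- The determinant of the leading `N × N` block of an `ℕ`-indexed family of entries. -/
def natDet (N : ℕ) (F : ℕ → ℕ → ℂ) : ℂ := (Matrix.of fun i j : Fin N => F i j).det

lemma natDet_congr {N : ℕ} {F G : ℕ → ℕ → ℂ} (h : ∀ i < N, ∀ j < N, F i j = G i j) :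
    natDet N F = natDet N G := by
  unfold natDet
  congr 1
  ext i j
  exact h i i.2 j j.2

lemma natDet_succ_of_col {N c : ℕ} (hc : c ≤ N) (F : ℕ → ℕ → ℂ) (h0 : F 0 c = 1)
    (h : ∀ i, F (i + 1) c = 0) :
    natDet (N + 1) F = (-1) ^ c * natDet N fun i j => F (i + 1) (if j < c then j else j + 1) := by
  unfold natDet
  rw [Matrix.det_succ_column _ (⟨c, by omega⟩ : Fin (N + 1)), Fin.sum_univ_succ]
  rw [Finset.sum_eq_zero]
  · simp only [Matrix.of_apply, Fin.val_zero, h0, add_zero, zero_add, mul_one]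
    congr 2
    ext i j
    simp only [Matrix.submatrix_apply, Matrix.of_apply, Fin.succAbove_zero, Fin.val_succ]
    congr 1
    simp only [Fin.succAbove, Fin.lt_def]
    split_ifs <;> simp_all
  · intro i _
    simp [h]

lemma natDet_cycle {N s : ℕ} (hs : s < N) (F : ℕ → ℕ → ℂ) :
    natDet N (fun i j => F i (if j < s + 1 then (j + 1) % (s + 1) else j))
      = (-1) ^ s * natDet N F := by
  unfold natDet
  have := Matrix.det_permute' (Fin.cycleRange (⟨s, hs⟩ : Fin N))
    (Matrix.of fun i j : Fin N => F i j)
  rw [Fin.sign_cycleRange] at this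
  push_cast at this
  rw [← this]
  congr 1
  ext i j
  simp only [Matrix.submatrix_apply, Matrix.of_apply, id]
  congr 1
  rcases lt_trichotomy (j : ℕ) s with hj | hj | hj
  · rw [Fin.coe_cycleRange_of_lt (by exact hj), if_pos (by omega), Nat.mod_eq_of_lt (by omega)]
  · have : NeZero N := ⟨by omega⟩
    rw [Fin.cycleRange_of_eq (Fin.ext hj)]
    simp [hj]
  · rw [Fin.cycleRange_of_gt (by exact hj), if_neg (by omega)]

lemma natDet_rotate {N s : ℕ} (hs : s < N) (F : ℕ → ℕ → ℂ) (t : ℕ) :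
    natDet N (fun i j => F i (if j < s + 1 then (j + t) % (s + 1) else j))
      = (-1) ^ (s * t) * natDet N F := by
  induction t with
  | zero =>
    simp only [add_zero, mul_zero, pow_zero, one_mul]
    refine natDet_congr fun i _ j _ => ?_
    split_ifs with h
    · rw [Nat.mod_eq_of_lt h]
    · rfl
  | succ t ih =>
    have := natDet_cycle hs
      (fun i j => F i (if j < s + 1 then (j + t) % (s + 1) else j))
    rw [mul_add, pow_add, mul_one, mul_comm (_ ^ (s * t)), mul_assoc, ← ih, ← this]
    refine natDet_congr fun i _ j _ => ?_
    by_cases h : j < s + 1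
    · simp only [h, if_true, if_pos (Nat.mod_lt _ (Nat.succ_pos s)), Nat.mod_add_mod]
      congr 2
      ring
    · simp [h]

lemma natDet_blocks_swap {N d n : ℕ} (hN : d + n ≤ N) (F : ℕ → ℕ → ℂ) :
    natDet N (fun i j => F i (if j < n then j + d else if j < n + d then j - n else j))
      = (-1) ^ (n * d) * natDet N F := by
  rcases Nat.eq_zero_or_pos (d + n) with h | h
  · obtain ⟨rfl, rfl⟩ : d = 0 ∧ n = 0 := by omega
    simp
  · obtain ⟨s, hs⟩ : ∃ s, d + n = s + 1 := ⟨d + n - 1, by omega⟩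
    have := natDet_rotate (N := N) (s := s) (by omega) F d
    have hpow : (-1 : ℂ) ^ (s * d) = (-1) ^ (n * d) := by
      rcases Nat.even_or_odd d with hd | hd
      · rw [(hd.mul_left s).neg_one_pow, (hd.mul_left n).neg_one_pow]
      · have : (-1 : ℂ) ^ s = (-1) ^ n := by
          obtain ⟨e, rfl⟩ := hd
          obtain rfl : s = 2 * e + n := by omega
          simp [pow_add]
        rw [pow_mul, this, pow_mul]
    rw [← hpow, ← this]
    refine natDet_congr fun i _ j _ => ?_
    congr 1
    split_ifs
    · rw [Nat.mod_eq_of_lt (by omega)]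
    · omega
    · rw [Nat.mod_eq_sub_mod (by omega), Nat.mod_eq_of_lt (by omega)]
      omega
    · omega
    · omega
    · rfl

lemma natDet_add_of_isUnit (n p : ℕ) (F : ℕ → ℕ → ℂ) (A : Matrix (Fin n) (Fin n) ℂ)
    (hA : IsUnit A.det) (h : ∀ i j : Fin n, F i j = A i j) :
    natDet (n + p) F = A.det * (Matrix.of (fun i j : Fin p => F (n + i) (n + j))
      - Matrix.of (fun (i : Fin p) (j : Fin n) => F (n + i) j) * A⁻¹
        * Matrix.of (fun (i : Fin n) (j : Fin p) => F i (n + j))).det := by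
  let := Matrix.invertibleOfIsUnitDet A hA
  rw [← Matrix.invOf_eq_nonsing_inv, ← Matrix.det_fromBlocks₁₁, natDet,
    ← Matrix.det_submatrix_equiv_self finSumFinEquiv]
  congr 1
  ext i j
  rcases i with i | i <;> rcases j with j | j <;> simp [h]

lemma natDet_add_of_isUnit' (n p : ℕ) (F : ℕ → ℕ → ℂ) (A : Matrix (Fin p) (Fin p) ℂ)
    (hA : IsUnit A.det) (h : ∀ i j : Fin p, F (n + i) (n + j) = A i j) :
    natDet (n + p) F = A.det * (Matrix.of (fun i j : Fin n => F i j)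
      - Matrix.of (fun (i : Fin n) (j : Fin p) => F i (n + j)) * A⁻¹
        * Matrix.of (fun (i : Fin p) (j : Fin n) => F (n + i) j)).det := by
  let := Matrix.invertibleOfIsUnitDet A hA
  rw [← Matrix.invOf_eq_nonsing_inv, ← Matrix.det_fromBlocks₂₂, natDet,
    ← Matrix.det_submatrix_equiv_self finSumFinEquiv]
  congr 1
  ext i j
  rcases i with i | i <;> rcases j with j | j <;> simp [h]

lemma stairCore_add_two {n m : ℕ} (hn : 2 ≤ n) (X Y : ℕ → ℕ → ℂ) (hX : ∀ i j, n ≤ i → X i j = 0)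
    (r c : ℕ) :
    stairCore n (m + 2) X Y r c
      = if r < n - 1 then (if c < n then Y (r + 1) c else 0)
        else if c < n then X (r - (n - 1) + 1) c
        else stairCore n (m + 1) X Y (r - (n - 1)) (c - n) := by
  have e1 : m + 2 - 1 = m + 1 := rfl
  have e2 : m + 2 - 2 = m := rfl
  have e3 : m + 1 - 1 = m := rfl
  have e4 : m + 1 - 2 = m - 1 := rfl
  unfold stairCore
  rw [e1, e2, e3, e4, Nat.add_mul m 1 (n - 1), Nat.add_mul m 1 n, one_mul, one_mul]
  by_cases h1 : r < n - 1
  · have hd : r / (n - 1) = 0 := Nat.div_eq_of_lt h1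
    rw [if_pos (by omega), if_pos h1, hd, Nat.mod_eq_of_lt h1]
    simp
  · obtain ⟨s, rfl⟩ : ∃ s, r = s + (n - 1) := ⟨r - (n - 1), by omega⟩
    rw [if_neg h1, Nat.add_sub_cancel, Nat.add_div_right _ (by omega), Nat.add_mod_right,
      Nat.add_mul, one_mul, Nat.add_sub_cancel, Nat.add_sub_add_right]
    have hm : m = 0 ∧ (m - 1) * n = 0 ∧ m * n = 0 ∧ m * (n - 1) = 0 ∨
        m * n = (m - 1) * n + n ∧ n - 1 ≤ m * (n - 1) := by
      rcases m with _ | m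
      · simp
      · right
        simp [Nat.add_mul]
    have hq : s / (n - 1) = 0 ∧ s / (n - 1) * n = 0 ∧ s % (n - 1) = s ∨
        1 ≤ s / (n - 1) ∧ s / (n - 1) * n = (s / (n - 1) - 1) * n + n ∧ n - 1 ≤ s := by
      rcases lt_or_ge s (n - 1) with h | h
      · left
        simp [Nat.div_eq_of_lt h, Nat.mod_eq_of_lt h]
      · right
        have h1 : 1 ≤ s / (n - 1) := (Nat.one_le_div_iff (by omega)).2 h
        refine ⟨h1, ?_, h⟩
        obtain ⟨q, hq⟩ := Nat.exists_eq_add_of_le' h1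
        rw [hq]
        simp [Nat.add_mul]
    generalize (m - 1) * n = mn' at *
    generalize m * n = mn at *
    generalize m * (n - 1) = mn1 at *
    generalize (s / (n - 1) - 1) * n = qn' at *
    generalize s / (n - 1) * n = qn at *
    generalize s / (n - 1) = q at *
    generalize s % (n - 1) = t at *
    have hXX : ∀ i j i' j', (n ≤ i ∧ n ≤ i') ∨ (i = i' ∧ j = j') → X i j = X i' j' := by
      rintro i j i' j' (⟨h, h'⟩ | ⟨rfl, rfl⟩)
      · rw [hX _ _ h, hX _ _ h']
      · rfl
    split_ifs <;> first
      | rfl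
      | (exfalso; omega)
      | (apply hXX; omega)
      | (congr 1; omega)
      | (rw [hX _ _ (by omega)])

/-- Extend a vector by zero to an `ℕ`-indexed family of entries. -/
def vecExt {n : ℕ} (v : Fin n → ℂ) : ℕ → ℂ := fun i => if h : i < n then v ⟨i, h⟩ else 0

lemma vecExt_coe {n : ℕ} (v : Fin n → ℂ) (i : Fin n) : vecExt v i = v i := by
  simp [vecExt]

lemma vecExt_of_le {n : ℕ} (v : Fin n → ℂ) {i : ℕ} (h : n ≤ i) : vecExt v i = 0 := by
  simp [vecExt, h]

/-- The core `stairCore n (m + 1) X Y` bordered on the left by the entries of index at least one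
of the vectors `v 0, …, v (c - 1)`. -/
def stairBorder (n m c : ℕ) (X Y : ℕ → ℕ → ℂ) (v : ℕ → Fin n → ℂ) : ℕ → ℕ → ℂ := fun i j =>
  if j < c then vecExt (v j) (i + 1) else stairCore n (m + 1) X Y i (j - c)

lemma vecExt_mulVec_toSq {n : ℕ} (X : ℕ → ℕ → ℂ) (hX : ∀ i j, n ≤ i → X i j = 0)
    (A : Matrix (Fin n) (Fin n) ℂ) (u : Fin n → ℂ) (i : ℕ) :
    vecExt ((toSq n X * A) *ᵥ u) i = (fun l : Fin n => X i l) ⬝ᵥ (A *ᵥ u) := by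
  rw [← Matrix.mulVec_mulVec]
  rcases lt_or_ge i n with h | h
  · rw [vecExt, dif_pos h]
    rfl
  · rw [vecExt_of_le _ h]
    simp [dotProduct, hX _ _ h]

lemma natDet_stairBorder_succ {n m c p : ℕ} (hn : 2 ≤ n) (hp : c + 1 ≤ p) (X Y : ℕ → ℕ → ℂ)
    (hX : ∀ i j, n ≤ i → X i j = 0) (hY : IsUnit (toSq n Y).det) (v : ℕ → Fin n → ℂ) :
    natDet (n - 1 + p) (stairBorder n (m + 1) c X Y v)
      = (-1) ^ (n * (c + 1) + 1) * (toSq n Y).det * natDet p (stairBorder n m (c + 1) X Y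
          fun j => (toSq n X * (toSq n Y)⁻¹) *ᵥ (if j < c then v j else basisVec n 0)) := by
  set F1 : ℕ → ℕ → ℂ := fun i j =>
    if j < c then vecExt (v j) i else if j = c then (if i = 0 then 1 else 0)
    else if i < n then (if j - (c + 1) < n then Y i (j - (c + 1)) else 0)
    else if j - (c + 1) < n then X (i - n + 1) (j - (c + 1))
    else stairCore n (m + 1) X Y (i - n) (j - (c + 1) - n) with hF1
  set F2 : ℕ → ℕ → ℂ := fun i j =>
    if j < n then (if i < n then Y i j else X (i - n + 1) j)
    else if j - n < c then vecExt (v (j - n)) i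
    else if j - n = c then (if i = 0 then 1 else 0)
    else if i < n then 0 else stairCore n (m + 1) X Y (i - n) (j - n - (c + 1)) with hF2
  have h1 : natDet (n + p) F1 = (-1) ^ c * natDet (n - 1 + p) (stairBorder n (m + 1) c X Y v) := by
    have hN : n + p = (n - 1 + p) + 1 := by omega
    rw [hN, natDet_succ_of_col (c := c) (by omega) F1 (by simp [hF1]) (by simp [hF1])]
    congr 1
    refine natDet_congr fun i _ j _ => ?_
    rw [stairBorder]
    by_cases hj : j < c
    · simp [hF1, hj]
    · simp only [hF1, if_neg hj, stairCore_add_two hn X Y hX, if_neg (show ¬ j + 1 < c by omega),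
        if_neg (show ¬ j + 1 = c by omega), show j + 1 - (c + 1) = j - c by omega]
      by_cases hi : i + 1 < n
      · rw [if_pos hi, if_pos (by omega : i < n - 1)]
      · rw [if_neg hi, if_neg (by omega : ¬ i < n - 1), show i + 1 - n = i - (n - 1) by omega]
  have h2 : natDet (n + p) F2 = (-1) ^ (n * (c + 1)) * natDet (n + p) F1 := by
    rw [← natDet_blocks_swap (N := n + p) (d := c + 1) (n := n) (by omega)]
    refine natDet_congr fun i _ j _ => ?_
    simp only [hF1, hF2]
    split_ifs <;> first
      | rfl
      | (exfalso; omega)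
      | (congr 1; omega)
  have h3 : natDet (n + p) F2 = (toSq n Y).det * ((-1) ^ (c + 1) * natDet p
      (stairBorder n m (c + 1) X Y
          fun j => (toSq n X * (toSq n Y)⁻¹) *ᵥ (if j < c then v j else basisVec n 0))) := by
    rw [natDet_add_of_isUnit n p F2 (toSq n Y) hY (by intro i j; simp [hF2, toSq])]
    congr 1
    have hprod : ∏ j : Fin p, (if (j : ℕ) < c + 1 then (-1 : ℂ) else 1) = (-1) ^ (c + 1) := by
      obtain ⟨q, rfl⟩ := Nat.exists_eq_add_of_le hp
      rw [Fin.prod_univ_add, Finset.prod_congr rfl fun x _ => if_pos (by simp; omega),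
        Finset.prod_congr rfl fun x _ => if_neg (by simp; omega)]
      simp
    rw [← hprod, natDet, ← Matrix.det_mul_row]
    congr 1
    ext i j
    have hentry : ∀ u : Fin n → ℂ, (∀ l : Fin n, F2 l (n + j) = u l) →
        (Matrix.of (fun (i : Fin p) (j : Fin n) => F2 (n + i) j) * (toSq n Y)⁻¹
          * Matrix.of (fun (i : Fin n) (j : Fin p) => F2 i (n + j))) i j
        = vecExt ((toSq n X * (toSq n Y)⁻¹) *ᵥ u) (i + 1) := by
      intro u hu
      rw [vecExt_mulVec_toSq X hX, Matrix.mul_assoc, ← funext hu]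
      have hrow : (fun l : Fin n => X (i + 1) l) = fun l : Fin n => F2 (n + i) l := by
        ext l
        simp [hF2]
      rw [hrow]
      rfl
    rw [Matrix.sub_apply]
    simp only [Matrix.of_apply]
    rcases lt_trichotomy (j : ℕ) c with hj | hj | hj
    · rw [hentry (v j) (fun l => by simp [hF2, hj, vecExt_coe])]
      simp [hF2, stairBorder, hj, hj.trans (Nat.lt_succ_self c),
        vecExt_of_le (v j) (Nat.le_add_right n i)]
    · rw [hentry (basisVec n 0) (fun l => by simp [hF2, hj, basisVec])]
      simp [hF2, stairBorder, hj]
      omega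
    · have hj1 : ¬ (j : ℕ) < c := by omega
      have hj2 : ¬ (j : ℕ) = c := by omega
      have hj3 : ¬ (j : ℕ) < c + 1 := by omega
      rw [hentry 0 (fun l => by simp [hF2, hj1, hj2])]
      simp [hF2, stairBorder, hj1, hj2, hj3, vecExt]
  have h4 : natDet (n - 1 + p) (stairBorder n (m + 1) c X Y v) = (-1) ^ c * natDet (n + p) F1 := by
    rw [h1, ← mul_assoc, ← mul_pow]
    simp
  have h5 : natDet (n + p) F1 = (-1) ^ (n * (c + 1)) * natDet (n + p) F2 := by
    rw [h2, ← mul_assoc, ← mul_pow]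
    simp
  have hc : (-1 : ℂ) ^ c * (-1) ^ c = 1 := by rw [← mul_pow]; simp
  rw [h4, h5, h3, pow_succ _ c, pow_succ _ (n * (c + 1))]
  linear_combination (-(toSq n Y).det * (-1) ^ (n * (c + 1)) * natDet p
      (stairBorder n m (c + 1) X Y
          fun j => (toSq n X * (toSq n Y)⁻¹) *ᵥ (if j < c then v j else basisVec n 0))) * hc

/-- The vectors `W ^ (c - 1) e₂, W ^ (c - 1) e₁, W ^ (c - 2) e₁, …, e₁`. -/
def krylovVec {n : ℕ} (W : Matrix (Fin n) (Fin n) ℂ) (c j : ℕ) : Fin n → ℂ :=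
  (W ^ (c - max j 1)) *ᵥ basisVec n (if j = 0 then 1 else 0)

lemma krylovVec_succ {n : ℕ} (W : Matrix (Fin n) (Fin n) ℂ) {c j : ℕ} (hc : 1 ≤ c)
    (hj : j < c + 1) :
    krylovVec W (c + 1) j = W *ᵥ (if j < c then krylovVec W c j else basisVec n 0) := by
  unfold krylovVec
  by_cases h : j < c
  · rw [if_pos h, show c + 1 - max j 1 = (c - max j 1) + 1 by omega, pow_succ', Matrix.mulVec_mulVec]
  · obtain rfl : j = c := by omega
    rw [if_neg h, show j + 1 - max j 1 = 1 by omega, pow_one, if_neg (by omega)]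

lemma natDet_stairBorder_krylovVec {n p : ℕ} (hn : 2 ≤ n) (X Y : ℕ → ℕ → ℂ)
    (hX : ∀ i j, n ≤ i → X i j = 0) (hY : IsUnit (toSq n Y).det) (m : ℕ) :
    ∀ c, 1 ≤ c → c + m ≤ p →
    natDet (m * (n - 1) + p) (stairBorder n m c X Y (krylovVec (toSq n X * (toSq n Y)⁻¹) c))
      = (-1) ^ (∑ i ∈ Finset.range m, (n * (c + i + 1) + 1)) * (toSq n Y).det ^ m
        * natDet p (stairBorder n 0 (c + m) X Y
            (krylovVec (toSq n X * (toSq n Y)⁻¹) (c + m))) := by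
  induction m with
  | zero => simp
  | succ m ih =>
    intro c hc hcp
    have hlt : c + 1 ≤ m * (n - 1) + p := by
      have := Nat.zero_le (m * (n - 1))
      omega
    rw [Nat.add_mul, one_mul, show m * (n - 1) + (n - 1) + p = n - 1 + (m * (n - 1) + p) by ring,
      natDet_stairBorder_succ hn hlt X Y hX hY]
    have hcongr : natDet (m * (n - 1) + p) (stairBorder n m (c + 1) X Y
        fun j => (toSq n X * (toSq n Y)⁻¹) *ᵥ
          (if j < c then krylovVec (toSq n X * (toSq n Y)⁻¹) c j else basisVec n 0))
        = natDet (m * (n - 1) + p) (stairBorder n m (c + 1) X Y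
            (krylovVec (toSq n X * (toSq n Y)⁻¹) (c + 1))) := by
      refine natDet_congr fun i _ j _ => ?_
      unfold stairBorder
      by_cases h : j < c + 1
      · rw [if_pos h, if_pos h, krylovVec_succ _ hc h]
      · rw [if_neg h, if_neg h]
    rw [hcongr, ih (c + 1) (by omega) (by omega), Finset.sum_range_succ', pow_add, pow_succ _ m,
      show c + 1 + m = c + (m + 1) by ring]
    simp only [add_zero, show ∀ i, c + 1 + i = c + (i + 1) from fun i => by ring]
    ring

/-- The projection of the first `k + b` coordinates onto the first `k` along the columns of
`[Y1; Y2]`. -/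
def stairProj (n k b : ℕ) (h : k + b ≤ n) (Y : Matrix (Fin n) (Fin n) ℂ) (x : Fin n → ℂ) :
    Fin k → ℂ :=
  (fun i => x (Fin.castLE (by omega) i))
    - ((Matrix.of fun (i : Fin k) (j : Fin b) =>
          Y (Fin.castLE (by omega) i) (Fin.castLE (by omega) j)) * (blockY2 n k b h Y)⁻¹) *ᵥ
      fun i : Fin b => x ⟨k + i, by omega⟩

lemma sum_eq_of_vanish {n k b : ℕ} (h : k + b ≤ n) (f : Fin n → ℂ)
    (hf : ∀ i : Fin n, k + b ≤ i → f i = 0) :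
    ∑ i, f i = ∑ i : Fin k, f (Fin.castLE (by omega) i) + ∑ i : Fin b, f ⟨k + i, by omega⟩ := by
  obtain ⟨r, rfl⟩ := Nat.exists_eq_add_of_le h
  have hr : ∑ i : Fin r, f (Fin.natAdd (k + b) i) = 0 :=
    Finset.sum_eq_zero fun i _ => hf _ (by simp)
  rw [Fin.sum_univ_add, Fin.sum_univ_add, hr, add_zero]
  rfl

lemma stairProj_mulVec {n k b : ℕ} (h : k + b ≤ n) (X Y : Matrix (Fin n) (Fin n) ℂ)
    (hX : ∀ i j : Fin n, (j : ℕ) < b → X i j = 0)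
    (hY : ∀ i j : Fin n, k + b ≤ i → (j : ℕ) < b → Y i j = 0)
    (hYinv : IsUnit Y.det) (hY2inv : IsUnit (blockY2 n k b h Y).det)
    (x : Fin n → ℂ) (hx : ∀ i : Fin n, k + b ≤ i → x i = 0) :
    stairProj n k b h Y ((X * Y⁻¹) *ᵥ x) = blockU n k b h X Y *ᵥ stairProj n k b h Y x := by
  unfold stairProj blockU
  set W := X * Y⁻¹ with hW
  set Y1 : Matrix (Fin k) (Fin b) ℂ := Matrix.of fun (i : Fin k) (j : Fin b) =>
    Y (Fin.castLE (by omega) i) (Fin.castLE (by omega) j) with hY1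
  set Y2 := blockY2 n k b h Y with hY2
  set W11 : Matrix (Fin k) (Fin k) ℂ := Matrix.of fun i j =>
    W (Fin.castLE (by omega) i) (Fin.castLE (by omega) j) with hW11
  set W21 : Matrix (Fin b) (Fin k) ℂ := Matrix.of fun i j =>
    W ⟨k + i, by omega⟩ (Fin.castLE (by omega) j) with hW21
  set W12 : Matrix (Fin k) (Fin b) ℂ := Matrix.of fun i j =>
    W (Fin.castLE (by omega) i) ⟨k + j, by omega⟩ with hW12
  set W22 : Matrix (Fin b) (Fin b) ℂ := Matrix.of fun i j =>
    W ⟨k + i, by omega⟩ ⟨k + j, by omega⟩ with hW22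
  set xt : Fin k → ℂ := fun i => x (Fin.castLE (by omega) i) with hxt
  set xb : Fin b → ℂ := fun i => x ⟨k + i, by omega⟩ with hxb
  have hWY : W * Y = X := by rw [hW, Matrix.mul_assoc, Matrix.nonsing_inv_mul _ hYinv, Matrix.mul_one]
  have hrow : ∀ (i : Fin n) (j : Fin b),
      ∑ l : Fin k, W i (Fin.castLE (by omega) l) * Y1 l j
        + ∑ l : Fin b, W i ⟨k + l, by omega⟩ * Y2 l j = 0 := by
    intro i j
    have := congrFun (congrFun hWY i) (Fin.castLE (by omega) j)
    rw [hX _ _ (by simp), Matrix.mul_apply, sum_eq_of_vanish h] at this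
    · exact this
    · intro l hl
      rw [hY l _ hl (by simp), mul_zero]
  have e1 : W11 * Y1 + W12 * Y2 = 0 := by
    ext i j
    exact hrow _ _
  have e2 : W21 * Y1 + W22 * Y2 = 0 := by
    ext i j
    exact hrow _ _
  have hcancel : ∀ {r : ℕ} (A : Matrix (Fin r) (Fin k) ℂ) (B : Matrix (Fin r) (Fin b) ℂ),
      A * Y1 + B * Y2 = 0 → B = -(A * (Y1 * Y2⁻¹)) := by
    intro r A B hAB
    rw [← Matrix.mul_assoc, eq_neg_of_add_eq_zero_left hAB, Matrix.neg_mul, neg_neg,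
      Matrix.mul_assoc, Matrix.mul_nonsing_inv _ hY2inv, Matrix.mul_one]
  have ht : (fun i : Fin k => (W *ᵥ x) (Fin.castLE (by omega) i)) = W11 *ᵥ xt + W12 *ᵥ xb := by
    ext i
    exact sum_eq_of_vanish h _ fun l hl => by rw [hx l hl, mul_zero]
  have hb : (fun i : Fin b => (W *ᵥ x) ⟨k + i, by omega⟩) = W21 *ᵥ xt + W22 *ᵥ xb := by
    ext i
    exact sum_eq_of_vanish h _ fun l hl => by rw [hx l hl, mul_zero]
  rw [ht, hb, hcancel _ _ e1, hcancel _ _ e2]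
  simp only [Matrix.sub_mulVec, Matrix.mulVec_sub, Matrix.mulVec_add, Matrix.neg_mulVec,
    Matrix.mulVec_neg, Matrix.mulVec_mulVec, Matrix.mul_assoc, Matrix.sub_mul]
  abel

lemma stairProj_basisVec {n k b s : ℕ} (h : k + b ≤ n) (hs : s < k)
    (Y : Matrix (Fin n) (Fin n) ℂ) :
    stairProj n k b h Y (basisVec n s) = basisVec k s := by
  have : (fun i : Fin b => basisVec n s ⟨k + i, by omega⟩) = 0 := by
    ext i
    simp [basisVec]
    omega
  rw [stairProj, this, Matrix.mulVec_zero, sub_zero]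
  rfl

lemma stairProj_pow_mulVec {n k b s : ℕ} (h : k + b ≤ n) (hs : s < k)
    (X Y : Matrix (Fin n) (Fin n) ℂ)
    (hX : ∀ i j : Fin n, (k + b ≤ i ∨ (j : ℕ) < b) → X i j = 0)
    (hY : ∀ i j : Fin n, k + b ≤ i → (j : ℕ) < b → Y i j = 0)
    (hYinv : IsUnit Y.det) (hY2inv : IsUnit (blockY2 n k b h Y).det) (p : ℕ) :
    stairProj n k b h Y ((X * Y⁻¹) ^ p *ᵥ basisVec n s)
      = blockU n k b h X Y ^ p *ᵥ basisVec k s := by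
  induction p with
  | zero => simp [stairProj_basisVec h hs]
  | succ p ih =>
    rw [pow_succ' (X * Y⁻¹), pow_succ' (blockU n k b h X Y),
      ← Matrix.mulVec_mulVec (basisVec n s) (X * Y⁻¹),
      ← Matrix.mulVec_mulVec (basisVec k s), ← ih]
    refine stairProj_mulVec h X Y (fun i j hj => hX i j (Or.inr hj)) hY hYinv hY2inv _
      fun i hi => ?_
    cases p with
    | zero =>
      simp [basisVec]
      omega
    | succ p =>
      rw [pow_succ', Matrix.mul_assoc, ← Matrix.mulVec_mulVec]
      have hrow : X i = 0 := funext fun j => hX i j (Or.inl hi)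
      change X i ⬝ᵥ _ = 0
      rw [hrow, zero_dotProduct]

lemma stairCore_one {n : ℕ} (X Y : ℕ → ℕ → ℂ) (r c : ℕ) :
    stairCore n 1 X Y r c = Y (r + 1) c := by
  simp [stairCore]

lemma natDet_stairBorder_zero {n k b : ℕ} (hk : 2 ≤ k) (hn : k + b ≤ n) (X Y : ℕ → ℕ → ℂ)
    (hX : ∀ i j : ℕ, (k + b ≤ i ∨ j < b) → X i j = 0)
    (hY : ∀ i j : ℕ, k + b ≤ i → j < b → Y i j = 0)
    (hYinv : IsUnit (toSq n Y).det)
    (hY2inv : IsUnit (blockY2 n k b hn (toSq n Y)).det) :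
    natDet (k + b - 1) (stairBorder n 0 (k - 1) X Y
        (krylovVec (toSq n X * (toSq n Y)⁻¹) (k - 1)))
      = (-1) ^ (k - 1) * ((blockY2 n k b hn (toSq n Y)).det
        * (Matrix.of fun i j : Fin k =>
            krylovVec (blockU n k b hn (toSq n X) (toSq n Y)) (k - 1) j i).det) := by
  set W := toSq n X * (toSq n Y)⁻¹ with hW
  set F : ℕ → ℕ → ℂ := fun i j =>
    if j < k then vecExt (krylovVec W (k - 1) j) i else Y i (j - k) with hF
  have hlast : ∀ i, vecExt (krylovVec W (k - 1) (k - 1)) i = if i = 0 then 1 else 0 := by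
    intro i
    rw [krylovVec, show k - 1 - max (k - 1) 1 = 0 by omega, pow_zero, Matrix.one_mulVec,
      if_neg (by omega)]
    unfold vecExt basisVec
    split_ifs <;> first | rfl | omega
  have hF1 : natDet (k + b) F = (-1) ^ (k - 1) * natDet (k + b - 1)
      (stairBorder n 0 (k - 1) X Y (krylovVec W (k - 1))) := by
    have hN : k + b = (k + b - 1) + 1 := by omega
    conv_lhs => rw [hN]
    rw [natDet_succ_of_col (c := k - 1) (by omega) F (by simp [hF, hlast]; omega)
      (by intro i; simp [hF, hlast]; omega)]
    congr 1
    refine natDet_congr fun i _ j _ => ?_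
    rw [stairBorder, stairCore_one]
    by_cases hj : j < k - 1
    · simp only [hF, if_pos hj, if_pos (show j < k by omega)]
    · simp only [hF, if_neg hj, if_neg (show ¬ j + 1 < k by omega)]
      congr 1
      omega
  have hF2 : natDet (k + b) F = (blockY2 n k b hn (toSq n Y)).det
        * (Matrix.of fun i j : Fin k =>
            krylovVec (blockU n k b hn (toSq n X) (toSq n Y)) (k - 1) j i).det := by
    rw [natDet_add_of_isUnit' k b F _ hY2inv (by intro i j; simp [hF, blockY2, toSq])]
    congr 2
    ext i j
    have hproj := stairProj_pow_mulVec (s := if (j : ℕ) = 0 then 1 else 0) hn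
      (by split_ifs <;> omega) (toSq n X) (toSq n Y)
      (fun i j hij => hX i j hij) (fun i j hi hj => hY i j hi hj) hYinv hY2inv
      (k - 1 - max (j : ℕ) 1)
    rw [Matrix.of_apply, krylovVec, ← hproj, stairProj]
    have htop : F i j = krylovVec W (k - 1) j (Fin.castLE (by omega) i) := by
      simp only [hF, if_pos j.2]
      exact vecExt_coe _ (Fin.castLE (by omega) i)
    have hbot : (Matrix.of fun (l : Fin b) (j : Fin k) => F (k + l) j)
        = Matrix.of fun (l : Fin b) (j : Fin k) =>
          krylovVec W (k - 1) j (⟨k + l, by omega⟩ : Fin n) := by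
      ext l j
      simp only [hF, Matrix.of_apply, if_pos j.2]
      exact vecExt_coe _ (⟨k + l, by omega⟩ : Fin n)
    have hleft : (Matrix.of fun (i : Fin k) (j : Fin b) => F i (k + j))
        = Matrix.of fun (i : Fin k) (j : Fin b) =>
          toSq n Y (Fin.castLE (by omega) i) (Fin.castLE (by omega) j) := by
      ext i l
      simp [hF, toSq]
    rw [hleft, hbot, Matrix.sub_apply, Matrix.of_apply, htop]
    rfl
  rw [← hF2, hF1, ← mul_assoc, ← mul_pow]
  simp

lemma neg_one_pow_sum_eq (n m : ℕ) :
    (-1 : ℂ) ^ (∑ i ∈ Finset.range m, (n * (1 + i + 1) + 1)) * (-1) ^ m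
      = (-1) ^ (n * (m * (m - 1) / 2)) := by
  have h : ∑ i ∈ Finset.range m, (n * (1 + i + 1) + 1) + m
      = n * (∑ i ∈ Finset.range m, i) + 2 * (n * m + m) := by
    induction m with
    | zero => simp
    | succ m ih =>
      rw [Finset.sum_range_succ, Finset.sum_range_succ]
      linarith
  rw [← Finset.sum_range_id, ← pow_add, h, pow_add, pow_mul _ 2]
  simp

lemma sminor_eq_natDet (Φ : ℕ → ℕ → ℂ) (i N : ℕ) :
    sminor Φ i N = natDet (N + 1 - i) fun r c => Φ (i - 1 + r) (i - 1 + c) := rfl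

/-- the minor `φ_{n+1}` via `U` (for `k ≥ 3`):
`φ_{n+1} = ε_{n+1} (det Y)^(k-2) det Y2 ·
  det[U^{k-2}e_1, U^{k-3}v_γ, U^{k-3}e_1, …, U e_1, e_1]`. -/
theorem statement8 (n k b : ℕ) (hk : 3 ≤ k) (hn : k + b ≤ n)
    (X Y : ℕ → ℕ → ℂ)
    (hX : ∀ i j : ℕ, (k + b ≤ i ∨ j < b) → X i j = 0)
    (hY : ∀ i j : ℕ, k + b ≤ i → j < b → Y i j = 0)
    (hYinv : IsUnit (toSq n Y).det)
    (hY2inv : IsUnit (blockY2 n k b hn (toSq n Y)).det)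
    (hYbar : detYbar n Y ≠ 0) :
    sminor (stairCore n k X Y) (n + 1) ((k - 1) * n + b)
      = (-1 : ℂ) ^ (n * ((k - 2) * (k - 3) / 2)) * (toSq n Y).det ^ (k - 2)
        * (blockY2 n k b hn (toSq n Y)).det
        * (Matrix.of fun i j : Fin k =>
            if (j : ℕ) = 0 then
              ((blockU n k b hn (toSq n X) (toSq n Y)) ^ (k - 2)).mulVec (basisVec k 0) i
            else if (j : ℕ) = 1 then
              ((blockU n k b hn (toSq n X) (toSq n Y)) ^ (k - 3)).mulVec
                (vGamma n k b hn X Y) i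
            else
              ((blockU n k b hn (toSq n X) (toSq n Y)) ^ (k - 1 - (j : ℕ))).mulVec
                (basisVec k 0) i).det := by
  obtain ⟨m, rfl⟩ : ∃ m, k = m + 2 := ⟨k - 2, by omega⟩
  have hXn : ∀ i j, n ≤ i → X i j = 0 := fun i j hi => hX i j (Or.inl (by omega))
  set U := blockU n (m + 2) b hn (toSq n X) (toSq n Y) with hU
  set W := toSq n X * (toSq n Y)⁻¹ with hW
  have hcol : ∀ i, vecExt (krylovVec W 1 0) (i + 1) = if i = 0 then 1 else 0 := by
    intro i
    have he : krylovVec W 1 0 = basisVec n 1 := by simp [krylovVec]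
    rw [he]
    simp only [vecExt, basisVec, Nat.add_eq_right]
    split_ifs <;> first | rfl | omega
  have hstart : sminor (stairCore n (m + 2) X Y) (n + 1) ((m + 2 - 1) * n + b)
      = natDet (m * (n - 1) + (m + 2 + b - 1)) (stairBorder n m 1 X Y (krylovVec W 1)) := by
    have hsize : m * (n - 1) + (m + 2 + b - 1) = m * n + b + 1 := by
      obtain ⟨q, rfl⟩ : ∃ q, n = q + 1 := ⟨n - 1, by omega⟩
      rw [Nat.add_sub_cancel, mul_add]
      omega
    have hsize' : (m + 2 - 1) * n + b + 1 - (n + 1) = m * n + b := by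
      rw [show m + 2 - 1 = m + 1 from rfl, add_mul]
      omega
    rw [hsize, natDet_succ_of_col (c := 0) (Nat.zero_le _) _ (by simp [stairBorder, hcol])
      (by intro i; simp [stairBorder, hcol]), pow_zero, one_mul]
    rw [sminor_eq_natDet, hsize']
    refine natDet_congr fun i _ j _ => ?_
    rw [stairCore_add_two (by omega) X Y hXn, if_neg (by omega), if_neg (by omega)]
    simp only [stairBorder, Nat.not_lt_zero, if_false]
    rw [if_neg (by omega)]
    congr 1 <;> omega
  have hfinal := natDet_stairBorder_zero (by omega) hn X Y hX hY hYinv hY2inv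
  rw [hstart, natDet_stairBorder_krylovVec (by omega) X Y hXn hYinv m 1 le_rfl (by omega),
    show 1 + m = m + 2 - 1 by omega, hfinal]
  set M : Matrix (Fin (m + 2)) (Fin (m + 2)) ℂ :=
    Matrix.of fun i j => krylovVec U (m + 2 - 1) j i with hM
  have hdet : (Matrix.of fun i j : Fin (m + 2) =>
      if (j : ℕ) = 0 then (U ^ (m + 2 - 2)).mulVec (basisVec (m + 2) 0) i
      else if (j : ℕ) = 1 then (U ^ (m + 2 - 3)).mulVec (vGamma n (m + 2) b hn X Y) i
      else (U ^ (m + 2 - 1 - (j : ℕ))).mulVec (basisVec (m + 2) 0) i).det = -M.det := by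
    set A := M.submatrix id (Equiv.swap 0 1) with hA
    have hAdet : A.det = -M.det := by
      rw [hA, Matrix.det_permute', Equiv.Perm.sign_swap Fin.zero_ne_one]
      simp
    rw [← hAdet, ← Matrix.det_updateCol_add_smul_self A (i := 1) (j := 0) Fin.zero_ne_one.symm
      (detYgamma n Y / detYbar n Y)]
    congr 1
    ext i j
    rw [Matrix.updateCol_apply]
    by_cases hj0 : j = 0
    · subst hj0
      simp [hA, hM, krylovVec]
    by_cases hj1 : j = 1
    · subst hj1
      obtain ⟨q, rfl⟩ : ∃ q, m = q + 1 := ⟨m - 1, by omega⟩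
      simp [hA, hM, krylovVec, vGamma, ← hU, Matrix.mulVec_add, Matrix.mulVec_smul,
        Matrix.mulVec_mulVec, pow_succ]
    · have hv0 : (j : ℕ) ≠ 0 := fun h => hj0 (Fin.ext h)
      have hv1 : (j : ℕ) ≠ 1 := fun h => hj1 (Fin.ext h)
      rw [if_neg hj1, hA, Matrix.submatrix_apply, Equiv.swap_apply_of_ne_of_ne hj0 hj1, hM]
      simp only [Matrix.of_apply, krylovVec, if_neg hv0, if_neg hv1, id]
      rw [max_eq_left (by omega)]
  rw [hdet, show m + 2 - 2 = m from rfl, show m + 2 - 3 = m - 1 from rfl,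
    ← neg_one_pow_sum_eq, show m + 2 - 1 = m + 1 from rfl, pow_succ _ m]
  ring

end
end

section
/- In the generic staircase situation (with n ≥ k + b, k ≥ 2, b ≥ 0), the core determinant φ_1 = det Φ is an irreducible element of the polynomial ring R. -/
open Matrix Finset

noncomputable section

namespace MvPolynomial

/-- The monomials of maximal weight in two factors contribute a monomial of the product. -/
lemma exists_weight_eq_add_of_isMax {σ R : Type*} [CommRing R] [IsDomain R] (w : σ → ℤ)
    {p q : MvPolynomial σ R} {x y : σ →₀ ℕ} (hx : coeff x p ≠ 0) (hy : coeff y q ≠ 0)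
    (hxmax : ∀ d, coeff d p ≠ 0 → Finsupp.weight w d ≤ Finsupp.weight w x)
    (hymax : ∀ d, coeff d q ≠ 0 → Finsupp.weight w d ≤ Finsupp.weight w y) :
    ∃ d, coeff d (p * q) ≠ 0 ∧
      Finsupp.weight w d = Finsupp.weight w x + Finsupp.weight w y := by
  classical
  set a := Finsupp.weight w x with ha
  set b := Finsupp.weight w y with hb
  have hpa : weightedHomogeneousComponent w a p ≠ 0 := fun h => hx <| by
    simpa [coeff_weightedHomogeneousComponent, ← ha] using congrArg (coeff x) h
  have hqb : weightedHomogeneousComponent w b q ≠ 0 := fun h => hy <| by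
    simpa [coeff_weightedHomogeneousComponent, ← hb] using congrArg (coeff y) h
  obtain ⟨d, hd⟩ := exists_coeff_ne_zero (mul_ne_zero hpa hqb)
  have hwd : Finsupp.weight w d = a + b :=
    ((weightedHomogeneousComponent_isWeightedHomogeneous a p).mul
      (weightedHomogeneousComponent_isWeightedHomogeneous b q)) hd
  refine ⟨d, ?_, hwd⟩
  convert hd using 1
  rw [coeff_mul, coeff_mul]
  refine Finset.sum_congr rfl fun u hu => ?_
  have hsum : Finsupp.weight w u.1 + Finsupp.weight w u.2 = a + b := by
    rw [← map_add, Finset.HasAntidiagonal.mem_antidiagonal.mp hu, hwd]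
  simp only [coeff_weightedHomogeneousComponent]
  by_cases h1 : coeff u.1 p = 0
  · simp [h1]
  by_cases h2 : coeff u.2 q = 0
  · simp [h2]
  have h3 := hxmax _ h1
  have h4 := hymax _ h2
  rw [if_pos (by omega), if_pos (by omega)]

lemma exists_isMax_weight {σ R : Type*} [CommRing R] (w : σ → ℤ) {p : MvPolynomial σ R}
    (hp : p ≠ 0) : ∃ x, coeff x p ≠ 0 ∧
      ∀ d, coeff d p ≠ 0 → Finsupp.weight w d ≤ Finsupp.weight w x := by
  obtain ⟨x, hx, h⟩ := Finset.exists_max_image p.support (fun d => Finsupp.weight w d)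
    (support_nonempty.mpr hp)
  exact ⟨x, mem_support_iff.mp hx, fun d hd => h d (mem_support_iff.mpr hd)⟩

lemma weight_neg_apply {σ : Type*} (w : σ → ℤ) (d : σ →₀ ℕ) :
    Finsupp.weight (-w) d = -Finsupp.weight w d := by
  simp [Finsupp.weight_apply, Finsupp.sum]

/-- A factor of a nonzero weighted homogeneous polynomial is weighted homogeneous. -/
lemma IsWeightedHomogeneous.weight_eq_of_mul {σ R : Type*} [CommRing R] [IsDomain R]
    {w : σ → ℤ} {p q : MvPolynomial σ R} {m : ℤ} (h : IsWeightedHomogeneous w (p * q) m)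
    (hpq : p * q ≠ 0) {d e : σ →₀ ℕ} (hd : coeff d p ≠ 0) (he : coeff e p ≠ 0) :
    Finsupp.weight w d = Finsupp.weight w e := by
  have hp := left_ne_zero_of_mul hpq
  have hq := right_ne_zero_of_mul hpq
  obtain ⟨x, hx, hxm⟩ := exists_isMax_weight w hp
  obtain ⟨y, hy, hym⟩ := exists_isMax_weight w hq
  obtain ⟨x', hx', hxm'⟩ := exists_isMax_weight (-w) hp
  obtain ⟨y', hy', hym'⟩ := exists_isMax_weight (-w) hq
  obtain ⟨z, hz, hzw⟩ := exists_weight_eq_add_of_isMax w hx hy hxm hym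
  obtain ⟨z', hz', hzw'⟩ := exists_weight_eq_add_of_isMax (-w) hx' hy' hxm' hym'
  have h1 := h hz
  have h2 := h hz'
  simp only [weight_neg_apply] at *
  have := hym _ hy'
  have := hxm _ hd
  have := hxm _ he
  have := hxm' _ hd
  have := hxm' _ he
  omega

end MvPolynomial

/-- In block coordinates, the core carries `Y` on the diagonal blocks and `X` on the blocks
directly below them. -/
lemma stairCore_apply {α : Type*} [Zero α] {n k b : ℕ} (hk : 2 ≤ k) (hn : k + b ≤ n)
    (Xf Yf : ℕ → ℕ → α) {s i t j : ℕ} (hi : i < n - 1) (hj : j < n)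
    (hr : s * (n - 1) + i < (k - 1) * n + b) (hc : t * n + j < (k - 1) * n + b) :
    stairCore n k Xf Yf (s * (n - 1) + i) (t * n + j) =
      if s = t then Yf (i + 1) j else if s = t + 1 then Xf (i + 1) j else 0 := by
  obtain ⟨l, rfl⟩ : ∃ l, k = l + 2 := ⟨k - 2, by omega⟩
  obtain ⟨m, rfl⟩ : ∃ m, n = m + 1 := ⟨n - 1, by omega⟩
  simp only [Nat.add_sub_cancel, show l + 2 - 1 = l + 1 by omega] at *
  have hdiv : (s * m + i) / m = s := by
    rw [mul_comm, Nat.mul_add_div (by omega), Nat.div_eq_of_lt hi, add_zero]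
  have hmod : (s * m + i) % m = i := by
    rw [mul_comm, Nat.mul_add_mod, Nat.mod_eq_of_lt hi]
  have hs : s ≤ l + 1 := by
    by_contra h
    have : (l + 2) * m ≤ s * m := Nat.mul_le_mul_right _ (by omega)
    linarith
  have ht : t ≤ l + 1 := by
    by_contra h
    have : (l + 2) * (m + 1) ≤ t * (m + 1) := Nat.mul_le_mul_right _ (by omega)
    linarith
  have hblock : ∀ u, (u * (m + 1) ≤ t * (m + 1) + j ∧
      t * (m + 1) + j < u * (m + 1) + (m + 1)) ↔ u = t := by
    intro u
    constructor
    · rintro ⟨h1, h2⟩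
      rcases lt_trichotomy u t with h | h | h
      · have : (u + 1) * (m + 1) ≤ t * (m + 1) := Nat.mul_le_mul_right _ h
        linarith
      · exact h
      · have : (t + 1) * (m + 1) ≤ u * (m + 1) := Nat.mul_le_mul_right _ h
        linarith
    · rintro rfl
      omega
  unfold stairCore
  simp only [Nat.add_sub_cancel, show l + 2 - 1 = l + 1 by omega, hdiv, hmod]
  by_cases hsl : s ≤ l
  · have : (s + 1) * m ≤ (l + 1) * m := Nat.mul_le_mul_right _ (by omega)
    rw [if_pos (by linarith)]
    simp only [hblock]
    by_cases hst : s = t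
    · subst hst
      simp
    · rw [if_neg hst, if_neg hst]
      by_cases hst' : s = t + 1
      · subst hst'
        rw [if_pos, if_pos rfl]
        · simp
        · have := (hblock t).2 rfl
          refine ⟨by omega, by simp, ?_⟩
          linarith
      · rw [if_neg hst', if_neg]
        rintro ⟨h1, h2, h3⟩
        obtain ⟨s, rfl⟩ : ∃ s', s = s' + 1 := ⟨s - 1, by omega⟩
        have := (hblock s).1 ⟨by simpa using h2, by linarith⟩
        omega
  · obtain rfl : s = l + 1 := by omega
    rw [if_neg (by omega)]
    have hrow : (l + 1) * m + i - (l + 1) * m = i := by omega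
    have h1 := hblock l
    have h2 := hblock (l + 1)
    rw [show l * (m + 1) + (m + 1) = (l + 1) * (m + 1) by ring] at h1
    simp only [h1, hrow]
    by_cases hlt : l = t
    · subst hlt
      simp
    · rw [if_neg hlt]
      by_cases hlt' : l + 1 = t
      · subst hlt'
        simp
      · rw [if_neg hlt', if_neg (show ¬l + 1 = t + 1 by omega), if_neg]
        intro h
        exact hlt' (h2.1 ⟨h, by linarith⟩)

/-- The weight on the variables of `Rgen` with row weights `u`, column weights `v`, and an extra
weight `c` on the entries of `X`. -/
def entryWeight (u v : ℕ → ℤ) (c : ℤ) : Bool × ℕ × ℕ → ℤ :=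
  fun x => u x.2.1 + v x.2.2 + if x.1 then c else 0

/-- The determinant of the generic core. -/
def coreDet (n k b : ℕ) : Rgen :=
  sminor (stairCore n k (genX n (k + b) b) (genY n (k + b) b)) 1 ((k - 1) * n + b)

lemma genX_isWeightedHomogeneous (n a b : ℕ) (u v : ℕ → ℤ) (c : ℤ) (i j : ℕ) :
    MvPolynomial.IsWeightedHomogeneous (entryWeight u v c) (genX n a b i j) (u i + v j + c) := by
  unfold genX
  split_ifs
  · simpa [entryWeight] using
      MvPolynomial.isWeightedHomogeneous_X ℂ (entryWeight u v c) (true, i, j)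
  · exact MvPolynomial.isWeightedHomogeneous_zero _ _ _

lemma genY_isWeightedHomogeneous (n a b : ℕ) (u v : ℕ → ℤ) (c : ℤ) (i j : ℕ) :
    MvPolynomial.IsWeightedHomogeneous (entryWeight u v c) (genY n a b i j) (u i + v j) := by
  unfold genY
  split_ifs
  · simpa [entryWeight] using
      MvPolynomial.isWeightedHomogeneous_X ℂ (entryWeight u v c) (false, i, j)
  · exact MvPolynomial.isWeightedHomogeneous_zero _ _ _

lemma det_isWeightedHomogeneous {σ R ι M : Type*} [CommRing R] [AddCommMonoid M] [Fintype ι]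
    [DecidableEq ι] (w : σ → M) (A : Matrix ι ι (MvPolynomial σ R)) (ρ γ : ι → M)
    (h : ∀ i j, MvPolynomial.IsWeightedHomogeneous w (A i j) (ρ i + γ j)) :
    MvPolynomial.IsWeightedHomogeneous w A.det (∑ i, ρ i + ∑ j, γ j) := by
  rw [Matrix.det_apply]
  refine MvPolynomial.IsWeightedHomogeneous.sum _ _ _ fun π _ => ?_
  have hp := MvPolynomial.IsWeightedHomogeneous.prod Finset.univ (fun i => A (π i) i)
    (fun i => ρ (π i) + γ i) (fun i _ => h (π i) i)
  rw [Finset.sum_add_distrib, Equiv.sum_comp π ρ] at hp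
  rcases Int.units_eq_one_or (Equiv.Perm.sign π) with hs | hs
  · simpa [hs] using hp
  · rw [hs, Units.neg_smul, one_smul]
    exact (MvPolynomial.weightedHomogeneousSubmodule R w _).neg_mem hp

lemma coreDet_isWeightedHomogeneous {n k b : ℕ} (hk : 2 ≤ k) (hn : k + b ≤ n) (u v : ℕ → ℤ)
    (c : ℤ) :
    MvPolynomial.IsWeightedHomogeneous (entryWeight u v c) (coreDet n k b)
      (∑ r ∈ range ((k - 1) * n + b), (u (r % (n - 1) + 1) + c * (r / (n - 1) : ℕ)) +
        ∑ r ∈ range ((k - 1) * n + b), (v (r % n) - c * (r / n : ℕ))) := by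
  unfold coreDet sminor
  rw [← Fin.sum_univ_eq_sum_range (fun r => u (r % (n - 1) + 1) + c * (r / (n - 1) : ℕ)),
    ← Fin.sum_univ_eq_sum_range (fun r => v (r % n) - c * (r / n : ℕ))]
  refine det_isWeightedHomogeneous (ι := Fin ((k - 1) * n + b)) _ _
    (fun r => u (r % (n - 1) + 1) + c * (r / (n - 1) : ℕ))
    (fun r => v (r % n) - c * (r / n : ℕ)) fun r s => ?_
  have hr := Nat.div_add_mod' (r : ℕ) (n - 1)
  have hs := Nat.div_add_mod' (s : ℕ) n
  have key := stairCore_apply hk hn (genX n (k + b) b) (genY n (k + b) b)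
    (Nat.mod_lt (r : ℕ) (show 0 < n - 1 by omega)) (Nat.mod_lt (s : ℕ) (show 0 < n by omega))
    (by rw [hr]; exact r.2) (by rw [hs]; exact s.2)
  rw [hr, hs] at key
  simp only [Matrix.of_apply, Nat.sub_self, zero_add, key]
  split_ifs with h1 h2
  · rw [h1, show ∀ x y z : ℤ, x + z + (y - z) = x + y by intros; ring]
    exact genY_isWeightedHomogeneous n (k + b) b u v c _ _
  · rw [h2, Nat.cast_add, Nat.cast_one,
      show ∀ x y z : ℤ, x + c * (z + 1) + (y - c * z) = x + y + c by intros; ring]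
    exact genX_isWeightedHomogeneous n (k + b) b u v c _ _
  · exact MvPolynomial.isWeightedHomogeneous_zero _ _ _

/-- The support of the `Y`-part of a sparse staircase pair with nonsingular core. -/
def sparseY (n k b : ℕ) (i j : ℕ) : Prop :=
  (1 ≤ i ∧ i < k ∧ j + 1 = b + i) ∨ (k ≤ i ∧ i < k + b ∧ j + k = i) ∨
    (k + b ≤ i ∧ i < n ∧ j = i)

/-- The support of the `X`-part of a sparse staircase pair with nonsingular core. -/
def sparseX (k b : ℕ) (i j : ℕ) : Prop := 1 ≤ i ∧ i < k ∧ j = b + i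

open Classical in
/-- The indicator of the support of the sparse staircase pair, after a permutation `σ` of the rows
and a permutation `τ` of the columns. -/
def sparsePoint (n k b : ℕ) (σ τ : Equiv.Perm ℕ) : Bool × ℕ × ℕ → ℂ := fun x =>
  if (x.1 = true ∧ sparseX k b (σ x.2.1) (τ x.2.2)) ∨
    (x.1 = false ∧ sparseY n k b (σ x.2.1) (τ x.2.2)) then 1 else 0

/-- The column of the unique nonzero entry of `Y` in row `i` of the sparse staircase pair. -/
def sparseCol (k b : ℕ) (i : ℕ) : ℕ :=
  if i < k then b + i - 1 else if i < k + b then i - k else i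

lemma sparseY_iff {n k b i j : ℕ} (h1 : 1 ≤ i) (hin : i < n) :
    sparseY n k b i j ↔ j = sparseCol k b i := by
  unfold sparseY sparseCol
  split_ifs <;> omega

/-- A permutation fixing everything outside the interval `[l, m)`. -/
def FixesOutside (l m : ℕ) (σ : Equiv.Perm ℕ) : Prop := ∀ i, i < l ∨ m ≤ i → σ i = i

lemma FixesOutside.mem_iff {l m : ℕ} {σ : Equiv.Perm ℕ} (h : FixesOutside l m σ) (i : ℕ) :
    (l ≤ σ i ∧ σ i < m) ↔ (l ≤ i ∧ i < m) := by
  constructor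
  · intro hi
    by_contra hc
    have := h i (by omega)
    omega
  · intro hi
    by_contra hc
    have := σ.injective (h (σ i) (by omega))
    omega

lemma eval_genX_sparsePoint {n k b : ℕ} (hn : k + b ≤ n) {σ τ : Equiv.Perm ℕ}
    (hσ : FixesOutside 1 (k + b) σ) (hτ : FixesOutside b n τ) (i j : ℕ)
    [Decidable (sparseX k b (σ i) (τ j))] :
    MvPolynomial.eval (sparsePoint n k b σ τ) (genX n (k + b) b i j) =
      if sparseX k b (σ i) (τ j) then 1 else 0 := by
  have h1 := hσ.mem_iff i
  have h2 := hτ.mem_iff j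
  unfold genX
  split_ifs with h h' h'
  · simp [sparsePoint, h']
  · simp [sparsePoint, h']
  · unfold sparseX at h'
    omega
  · simp

lemma eval_genY_sparsePoint {n k b : ℕ} (hn : k + b ≤ n) {σ τ : Equiv.Perm ℕ}
    (hσ : FixesOutside 1 (k + b) σ) (hτ : FixesOutside b n τ) (i j : ℕ)
    [Decidable (sparseY n k b (σ i) (τ j))] :
    MvPolynomial.eval (sparsePoint n k b σ τ) (genY n (k + b) b i j) =
      if sparseY n k b (σ i) (τ j) then 1 else 0 := by
  have h1 := hσ.mem_iff i
  have h2 := hτ.mem_iff j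
  have h3 := hσ i
  have h4 := hτ j
  unfold genY
  split_ifs with h h' h'
  · simp [sparsePoint, h']
  · simp [sparsePoint, h']
  · unfold sparseY at h'
    omega
  · simp

lemma eval_coreDet_sparsePoint_ne_zero {n k b : ℕ} (hk : 2 ≤ k) (hn : k + b ≤ n)
    {σ τ : Equiv.Perm ℕ} (hσ : FixesOutside 1 (k + b) σ) (hτ : FixesOutside b n τ) :
    MvPolynomial.eval (sparsePoint n k b σ τ) (coreDet n k b) ≠ 0 := by
  classical
  set N := (k - 1) * n + b with hN
  set f := MvPolynomial.eval (sparsePoint n k b σ τ)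
  set Φ := stairCore n k (genX n (k + b) b) (genY n (k + b) b)
  have hdet : f (coreDet n k b) = (Matrix.of fun r c : Fin N => f (Φ r c)).det := by
    simp only [coreDet, sminor, RingHom.map_det, Nat.sub_self, zero_add]
    rfl
  rw [hdet]
  intro h0
  obtain ⟨v, hv0, hv⟩ := Matrix.exists_mulVec_eq_zero_iff.mpr h0
  set vN : ℕ → ℂ := fun c => if h : c < N then v ⟨c, h⟩ else 0 with hvN
  set V : ℕ → ℕ → ℂ := fun t l => vN (t * n + τ.symm l) with hV
  have hτs : FixesOutside b n τ.symm := fun i hi => by rw [Equiv.symm_apply_eq, hτ i hi]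
  have hσs : FixesOutside 1 (k + b) σ.symm := fun i hi => by rw [Equiv.symm_apply_eq, hσ i hi]
  have hτlt : ∀ l < n, τ.symm l < n := fun l hl => by
    have := hτs.mem_iff l
    have := hτs l
    omega
  have hcol : ∀ c t j, j < n → (c = t * n + j ↔ c / n = t ∧ c % n = j) := by
    intro c t j hj
    constructor
    · rintro rfl
      constructor
      · rw [mul_comm, Nat.mul_add_div (by omega), Nat.div_eq_of_lt hj, add_zero]
      · rw [mul_comm, Nat.mul_add_mod, Nat.mod_eq_of_lt hj]
    · rintro ⟨rfl, rfl⟩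
      rw [Nat.div_add_mod']
  -- the equations given by the rows of the core
  have hrow : ∀ t i, 1 ≤ i → i < n → t * (n - 1) + (σ.symm i - 1) < N →
      V t (sparseCol k b i) + (if 1 ≤ t ∧ i < k then V (t - 1) (b + i) else 0) = 0 := by
    intro t i h1 hin hR
    have hi0 : 1 ≤ σ.symm i ∧ σ.symm i < n := by
      have := hσs.mem_iff i
      have := hσs i
      omega
    have hcoln : sparseCol k b i < n := by
      unfold sparseCol
      split_ifs <;> omega
    have hentry : ∀ c < N, f (Φ (t * (n - 1) + (σ.symm i - 1)) c) =
        (if c = t * n + τ.symm (sparseCol k b i) then 1 else 0) +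
          if (1 ≤ t ∧ i < k) ∧ c = (t - 1) * n + τ.symm (b + i) then 1 else 0 := by
      intro c hc
      have hcd := Nat.div_add_mod' c n
      have key := stairCore_apply hk hn (genX n (k + b) b) (genY n (k + b) b)
        (show σ.symm i - 1 < n - 1 by omega) (Nat.mod_lt c (show 0 < n by omega)) hR
        (by rwa [hcd])
      rw [hcd, Nat.sub_add_cancel hi0.1] at key
      have hY : c = t * n + τ.symm (sparseCol k b i) ↔
          t = c / n ∧ τ (c % n) = sparseCol k b i := by
        rw [hcol c t _ (hτlt _ hcoln), Equiv.eq_symm_apply, eq_comm (a := t)]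
      have hX : ((1 ≤ t ∧ i < k) ∧ c = (t - 1) * n + τ.symm (b + i)) ↔
          t = c / n + 1 ∧ i < k ∧ τ (c % n) = b + i := by
        constructor
        · rintro ⟨⟨ht, hik⟩, hc⟩
          rw [hcol c (t - 1) _ (hτlt _ (by omega)), Equiv.eq_symm_apply] at hc
          exact ⟨by omega, hik, hc.2⟩
        · rintro ⟨ht, hik, hc⟩
          rw [hcol c (t - 1) _ (hτlt _ (by omega)), Equiv.eq_symm_apply]
          exact ⟨⟨by rw [ht]; exact Nat.le_add_left _ _, hik⟩,
            by rw [ht, Nat.add_sub_cancel], hc⟩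
      simp only [Φ, key, hX, hY]
      by_cases ht : t = c / n
      · subst ht
        simp only [if_true, f]
        rw [eval_genY_sparsePoint hn hσ hτ]
        simp [sparseY_iff h1 hin]
      · rw [if_neg ht]
        by_cases ht' : t = c / n + 1
        · simp only [ht', if_true, f]
          rw [eval_genX_sparsePoint hn hσ hτ]
          simp [sparseX, h1]
        · simp [ht, ht']
    have hsum := congrFun hv ⟨t * (n - 1) + (σ.symm i - 1), hR⟩
    simp only [Matrix.mulVec, dotProduct, Matrix.of_apply, Pi.zero_apply] at hsum
    have hsum' : ∑ c ∈ range N, f (Φ (t * (n - 1) + (σ.symm i - 1)) c) * vN c = 0 := by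
      rw [← Fin.sum_univ_eq_sum_range (fun c => f (Φ (t * (n - 1) + (σ.symm i - 1)) c) * vN c),
        ← hsum]
      refine Finset.sum_congr rfl fun c _ => ?_
      simp [hvN]
    rw [Finset.sum_congr rfl fun c hc => by rw [hentry c (Finset.mem_range.mp hc)]] at hsum'
    have hout : ∀ c, c ∉ range N → vN c = 0 := fun c hc => by
      simp only [hvN]
      rw [dif_neg (by simpa using hc)]
    simp only [add_mul, Finset.sum_add_distrib, ite_and, ite_mul, one_mul, zero_mul,
      Finset.sum_ite_irrel, Finset.sum_const_zero, Finset.sum_ite_eq'] at hsum'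
    rw [ite_and]
    refine Eq.trans ?_ hsum'
    congr 1
    · split_ifs with h
      · rfl
      · exact hout _ h
    · split_ifs with ha hb h
      · rfl
      · exact hout _ h
      · rfl
      · rfl
  obtain ⟨m, rfl⟩ : ∃ m, n = m + 1 := ⟨n - 1, by omega⟩
  obtain ⟨l, rfl⟩ : ∃ l, k = l + 1 := ⟨k - 1, by omega⟩
  simp only [Nat.add_sub_cancel] at hrow hN
  have hlast : ∀ j, b ≤ j → V l j = 0 := by
    intro j hj
    have hbj : b ≤ τ.symm j := by
      have := hτs.mem_iff j
      have := hτs j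
      omega
    simp only [hV, hvN]
    rw [dif_neg (by omega)]
  have hRlt : ∀ t i, t ≤ l → i < l + 1 + b → t * m + (σ.symm i - 1) < N := by
    intro t i ht hi
    have h1 : t * m ≤ l * m := Nat.mul_le_mul_right _ ht
    have h2 : σ.symm i < l + 1 + b := by
      have := hσs.mem_iff i
      have := hσs i
      omega
    have h3 : σ.symm i - 1 < l + b := by omega
    rw [hN]
    linarith
  have hpencil : ∀ t i, t ≤ l → 1 ≤ i → i ≤ l →
      V t (b + i - 1) + (if 1 ≤ t then V (t - 1) (b + i) else 0) = 0 := by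
    intro t i ht h1 hi
    simpa [sparseCol, Nat.lt_succ_of_le hi] using
      hrow t i h1 (by omega) (hRlt t i ht (by omega))
  have hlow : ∀ t i, i + t + 1 ≤ l → V t (b + i) = 0 := by
    intro t
    induction t with
    | zero => exact fun i hi => by simpa using hpencil 0 (i + 1) (by omega) (by omega) (by omega)
    | succ t ih =>
      intro i hi
      have h := hpencil (t + 1) (i + 1) (by omega) (by omega) (by omega)
      simpa [ih (i + 1) (by omega)] using h
  have hhigh : ∀ s t i, t + s = l → i ≤ l → l ≤ i + t → V t (b + i) = 0 := by
    intro s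
    induction s with
    | zero =>
      rintro t i rfl - -
      exact hlast _ (by omega)
    | succ s ih =>
      intro t i hts hil hi
      have h := hpencil (t + 1) i (by omega) (by omega) hil
      have h2 := ih (t + 1) (i - 1) (by omega) (by omega) (by omega)
      rw [show b + (i - 1) = b + i - 1 by omega] at h2
      simpa [h2] using h
  have hzero : ∀ t j, t ≤ l → j < m + 1 → V t j = 0 := by
    intro t j ht hj
    by_cases hjb : j < b
    · have h := hrow t (l + 1 + j) (by omega) (by omega) (hRlt t _ ht (by omega))
      simpa [sparseCol, hjb, show ¬l + 1 + j ≤ l by omega] using h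
    by_cases hjk : j < l + 1 + b
    · obtain ⟨i, rfl⟩ : ∃ i, j = b + i := ⟨j - b, by omega⟩
      by_cases hi : i + t + 1 ≤ l
      · exact hlow t i hi
      · exact hhigh (l - t) t i (by omega) (by omega) (by omega)
    rcases ht.eq_or_lt with rfl | htl
    · exact hlast j (by omega)
    · have hR : t * m + (σ.symm j - 1) < N := by
        have h1 : (t + 1) * m ≤ l * m := Nat.mul_le_mul_right _ htl
        rw [hσs j (by omega), hN]
        have : j - 1 < m := by omega
        linarith
      have h := hrow t j (by omega) hj hR
      simpa [sparseCol, hjk, show ¬j < l + 1 by omega] using h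
  apply hv0
  funext c
  have hcd := Nat.div_add_mod' (c : ℕ) (m + 1)
  have hct : (c : ℕ) / (m + 1) ≤ l := by
    rw [← Nat.lt_succ_iff, Nat.div_lt_iff_lt_mul (by omega)]
    have hc := c.2.trans_eq hN
    have : b < m + 1 := by omega
    simp only [Nat.succ_eq_add_one]
    linarith
  have hcm : τ (c % (m + 1)) < m + 1 := by
    have := hτ.mem_iff (c % (m + 1))
    have := hτ (c % (m + 1))
    have := Nat.mod_lt (c : ℕ) (show 0 < m + 1 by omega)
    omega
  have h := hzero _ _ hct hcm
  simpa [hV, hvN, hcd] using h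

/-- The weight of a monomial for a weighting of the variables of `Rgen` by their rows. -/
def rowWeight (m : Bool × ℕ × ℕ →₀ ℕ) : (ℕ → ℤ) →ₗ[ℤ] ℤ :=
  ∑ x ∈ m.support, (m x : ℤ) • LinearMap.proj x.2.1

/-- The weight of a monomial for a weighting of the variables of `Rgen` by their columns. -/
def colWeight (m : Bool × ℕ × ℕ →₀ ℕ) : (ℕ → ℤ) →ₗ[ℤ] ℤ :=
  ∑ x ∈ m.support, (m x : ℤ) • LinearMap.proj x.2.2

/-- The degree of a monomial of `Rgen` in the entries of `X`. -/
def xDegree (m : Bool × ℕ × ℕ →₀ ℕ) : ℤ := ∑ x ∈ m.support, (m x : ℤ) * if x.1 then 1 else 0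

lemma rowWeight_apply (m : Bool × ℕ × ℕ →₀ ℕ) (u : ℕ → ℤ) :
    rowWeight m u = ∑ x ∈ m.support, (m x : ℤ) * u x.2.1 := by
  simp [rowWeight, LinearMap.sum_apply]

lemma colWeight_apply (m : Bool × ℕ × ℕ →₀ ℕ) (v : ℕ → ℤ) :
    colWeight m v = ∑ x ∈ m.support, (m x : ℤ) * v x.2.2 := by
  simp [colWeight, LinearMap.sum_apply]

lemma weight_entryWeight (u v : ℕ → ℤ) (c : ℤ) (m : Bool × ℕ × ℕ →₀ ℕ) :
    Finsupp.weight (entryWeight u v c) m = rowWeight m u + colWeight m v + c * xDegree m := by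
  rw [rowWeight_apply, colWeight_apply, xDegree, Finset.mul_sum, ← Finset.sum_add_distrib,
    ← Finset.sum_add_distrib, Finsupp.weight_apply, Finsupp.sum]
  refine Finset.sum_congr rfl fun x _ => ?_
  simp only [entryWeight, nsmul_eq_mul]
  split_ifs <;> ring

lemma rowWeight_nonneg (m : Bool × ℕ × ℕ →₀ ℕ) {u : ℕ → ℤ} (hu : 0 ≤ u) : 0 ≤ rowWeight m u := by
  rw [rowWeight_apply]
  exact Finset.sum_nonneg fun x _ => mul_nonneg (Nat.cast_nonneg _) (hu _)

lemma rowWeight_single_pos {m : Bool × ℕ × ℕ →₀ ℕ} {x : Bool × ℕ × ℕ} (hx : x ∈ m.support) :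
    0 < rowWeight m (Pi.single x.2.1 1) := by
  rw [rowWeight_apply]
  refine Finset.sum_pos' (fun y _ => mul_nonneg (Nat.cast_nonneg _) ?_) ⟨x, hx, ?_⟩
  · exact (Pi.single_nonneg.mpr zero_le_one : (0 : ℕ → ℤ) ≤ Pi.single x.2.1 1) _
  · simpa using Nat.pos_of_ne_zero (Finsupp.mem_support_iff.mp hx)

lemma exists_coeff_ne_zero_of_eval_ne_zero {σ R : Type*} [CommRing R] {p : MvPolynomial σ R}
    {z : σ → R} (h : MvPolynomial.eval z p ≠ 0) :
    ∃ m, MvPolynomial.coeff m p ≠ 0 ∧ ∀ x ∈ m.support, z x ≠ 0 := by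
  rw [MvPolynomial.eval_eq] at h
  obtain ⟨m, hm, hne⟩ := Finset.exists_ne_zero_of_sum_ne_zero h
  refine ⟨m, MvPolynomial.mem_support_iff.mp hm, fun x hx hz => hne ?_⟩
  rw [Finset.prod_eq_zero hx, mul_zero]
  rw [hz, zero_pow (Finsupp.mem_support_iff.mp hx)]

lemma coreDet_ne_zero {n k b : ℕ} (hk : 2 ≤ k) (hn : k + b ≤ n) : coreDet n k b ≠ 0 := by
  intro h
  refine eval_coreDet_sparsePoint_ne_zero hk hn (σ := 1) (τ := 1) (fun _ _ => rfl)
    (fun _ _ => rfl) ?_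
  rw [h, map_zero]

lemma weight_eq_of_coreDet_eq_mul {n k b : ℕ} (hk : 2 ≤ k) (hn : k + b ≤ n) {G H : Rgen}
    (hF : coreDet n k b = G * H) (u v : ℕ → ℤ) (c : ℤ) {m m' : Bool × ℕ × ℕ →₀ ℕ}
    (hm : MvPolynomial.coeff m G ≠ 0) (hm' : MvPolynomial.coeff m' G ≠ 0) :
    rowWeight m u + colWeight m v + c * xDegree m =
      rowWeight m' u + colWeight m' v + c * xDegree m' := by
  rw [← weight_entryWeight, ← weight_entryWeight]
  exact (hF ▸ coreDet_isWeightedHomogeneous hk hn u v c).weight_eq_of_mul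
    (hF ▸ coreDet_ne_zero hk hn) hm hm'

/-- A weight vanishing on the support of a permuted sparse point vanishes on the monomials of any
factor of the core determinant. -/
lemma weight_eq_zero_of_sparse {n k b : ℕ} (hk : 2 ≤ k) (hn : k + b ≤ n) {G H : Rgen}
    (hF : coreDet n k b = G * H) {m : Bool × ℕ × ℕ →₀ ℕ} (hm : MvPolynomial.coeff m G ≠ 0)
    {σ τ : Equiv.Perm ℕ} (hσ : FixesOutside 1 (k + b) σ) (hτ : FixesOutside b n τ)
    {u v : ℕ → ℤ} {c : ℤ} (hY : ∀ i j, sparseY n k b i j → u i + v j = 0)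
    (hX : ∀ i j, sparseX k b i j → u i + v j + c = 0) :
    rowWeight m (u ∘ σ) + colWeight m (v ∘ τ) + c * xDegree m = 0 := by
  have h := eval_coreDet_sparsePoint_ne_zero hk hn hσ hτ
  rw [hF, map_mul] at h
  obtain ⟨m', hm', hz⟩ := exists_coeff_ne_zero_of_eval_ne_zero (left_ne_zero_of_mul h)
  rw [weight_eq_of_coreDet_eq_mul hk hn hF _ _ c hm hm', ← weight_entryWeight,
    Finsupp.weight_apply, Finsupp.sum]
  refine Finset.sum_eq_zero fun x hx => ?_
  have hzx := hz x hx
  obtain ⟨t, i, j⟩ := x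
  simp only [sparsePoint, ne_eq, ite_eq_right_iff, one_ne_zero, imp_false, not_not] at hzx
  rcases hzx with ⟨rfl, h⟩ | ⟨rfl, h⟩
  · simp [entryWeight, hX _ _ h]
  · simp [entryWeight, hY _ _ h]

lemma fixesOutside_swap {l m i j : ℕ} (hi : l ≤ i ∧ i < m) (hj : l ≤ j ∧ j < m) :
    FixesOutside l m (Equiv.swap i j) := fun x hx =>
  Equiv.swap_apply_of_ne_of_ne (by omega) (by omega)

lemma comp_swap_eq (u : ℕ → ℤ) (i j : ℕ) :
    u ∘ Equiv.swap i j = u + (u j - u i) • (Pi.single i 1 - Pi.single j 1 : ℕ → ℤ) := by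
  funext x
  by_cases hi : x = i
  · subst hi
    by_cases hj : x = j
    · subst hj
      simp
    · simp [hj]
  · by_cases hj : x = j
    · subst hj
      simp [hi]
    · simp [hi, hj, Equiv.swap_apply_of_ne_of_ne]

/-- Row weights vanishing, together with `sparseColWeight` and weight `-1` on `X`, on the sparse
staircase pair, and separating the rows that meet `X`. -/
def sparseRowWeight (k b i : ℕ) : ℤ := if i < k + b then -i else b - 1 - i

/-- Column weights vanishing, together with `sparseRowWeight` and weight `-1` on `X`, on the sparse
staircase pair, and separating the columns that meet `X`. -/
def sparseColWeight (k b j : ℕ) : ℤ := if j < b then k + j else j - b + 1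

lemma sparseWeight_Y {n k b i j : ℕ} (h : sparseY n k b i j) :
    sparseRowWeight k b i + sparseColWeight k b j = 0 := by
  unfold sparseY at h
  unfold sparseRowWeight sparseColWeight
  split_ifs <;> omega

lemma sparseWeight_X {k b i j : ℕ} (h : sparseX k b i j) :
    sparseRowWeight k b i + sparseColWeight k b j + -1 = 0 := by
  unfold sparseX at h
  unfold sparseRowWeight sparseColWeight
  split_ifs <;> omega

section Factor

variable {n k b : ℕ} {G H : Rgen} {m : Bool × ℕ × ℕ →₀ ℕ}

lemma rowWeight_single_eq (hk : 2 ≤ k) (hn : k + b ≤ n) (hF : coreDet n k b = G * H)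
    (hm : MvPolynomial.coeff m G ≠ 0) {i j : ℕ} (hi : 1 ≤ i ∧ i < k + b) (hj : 1 ≤ j ∧ j < k + b) :
    rowWeight m (Pi.single i 1) = rowWeight m (Pi.single j 1) := by
  have h0 := weight_eq_zero_of_sparse hk hn hF hm (σ := 1) (τ := 1) (fun _ _ => rfl)
    (fun _ _ => rfl) (fun _ _ => sparseWeight_Y) (fun _ _ => sparseWeight_X)
  have h1 := weight_eq_zero_of_sparse hk hn hF hm (τ := 1) (fixesOutside_swap hi hj)
    (fun _ _ => rfl) (fun _ _ => sparseWeight_Y) (fun _ _ => sparseWeight_X)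
  rw [comp_swap_eq, map_add, map_smul, map_sub, smul_eq_mul] at h1
  rcases eq_or_ne i j with rfl | hij
  · rfl
  have hne : sparseRowWeight k b j - sparseRowWeight k b i ≠ 0 := by
    unfold sparseRowWeight
    split_ifs <;> omega
  have h2 : (sparseRowWeight k b j - sparseRowWeight k b i) *
      (rowWeight m (Pi.single i 1) - rowWeight m (Pi.single j 1)) = 0 := by
    simp only [Equiv.Perm.coe_one, Function.comp_id] at h0 h1
    linarith
  exact sub_eq_zero.mp ((mul_eq_zero.mp h2).resolve_left hne)

lemma colWeight_single_eq (hk : 2 ≤ k) (hn : k + b ≤ n) (hF : coreDet n k b = G * H)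
    (hm : MvPolynomial.coeff m G ≠ 0) {i j : ℕ} (hi : b ≤ i ∧ i < n) (hj : b ≤ j ∧ j < n) :
    colWeight m (Pi.single i 1) = colWeight m (Pi.single j 1) := by
  have h0 := weight_eq_zero_of_sparse hk hn hF hm (σ := 1) (τ := 1) (fun _ _ => rfl)
    (fun _ _ => rfl) (fun _ _ => sparseWeight_Y) (fun _ _ => sparseWeight_X)
  have h1 := weight_eq_zero_of_sparse hk hn hF hm (σ := 1) (fun _ _ => rfl)
    (fixesOutside_swap hi hj) (fun _ _ => sparseWeight_Y) (fun _ _ => sparseWeight_X)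
  rw [comp_swap_eq, map_add, map_smul, map_sub, smul_eq_mul] at h1
  rcases eq_or_ne i j with rfl | hij
  · rfl
  have hne : sparseColWeight k b j - sparseColWeight k b i ≠ 0 := by
    unfold sparseColWeight
    split_ifs <;> omega
  have h2 : (sparseColWeight k b j - sparseColWeight k b i) *
      (colWeight m (Pi.single i 1) - colWeight m (Pi.single j 1)) = 0 := by
    simp only [Equiv.Perm.coe_one, Function.comp_id] at h0 h1
    linarith
  exact sub_eq_zero.mp ((mul_eq_zero.mp h2).resolve_left hne)

lemma rowWeight_single_eq_colWeight_single (hk : 2 ≤ k) (hn : k + b ≤ n)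
    (hF : coreDet n k b = G * H) (hm : MvPolynomial.coeff m G ≠ 0) {i : ℕ} (hi : k + b ≤ i) :
    rowWeight m (Pi.single i 1) = colWeight m (Pi.single i 1) := by
  have h := weight_eq_zero_of_sparse hk hn hF hm (σ := 1) (τ := 1) (u := Pi.single i 1)
    (v := -Pi.single i 1) (c := 0) (fun _ _ => rfl) (fun _ _ => rfl)
    (fun x y h => by
      unfold sparseY at h
      simp only [Pi.neg_apply, Pi.single_apply]
      split_ifs <;> omega)
    (fun x y h => by
      unfold sparseX at h
      simp only [Pi.neg_apply, Pi.single_apply]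
      split_ifs <;> omega)
  simp only [Equiv.Perm.coe_one, Function.comp_id, map_neg, zero_mul] at h
  linarith

/-- Comparing row and column degrees in the square pencil part of the sparse staircase pair. -/
lemma pencil_rowWeight_eq (hk : 2 ≤ k) (hn : k + b ≤ n)
    (hF : coreDet n k b = G * H) (hm : MvPolynomial.coeff m G ≠ 0) :
    (k - 1 : ℤ) * rowWeight m (Pi.single 1 1) = k * colWeight m (Pi.single b 1) := by
  have h := weight_eq_zero_of_sparse hk hn hF hm (σ := 1) (τ := 1)
    (u := ∑ i ∈ Ico 1 k, Pi.single i 1) (v := -∑ j ∈ Ico b (b + k), Pi.single j 1) (c := 0)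
    (fun _ _ => rfl) (fun _ _ => rfl)
    (fun x y h => by
      unfold sparseY at h
      simp only [Pi.neg_apply, Finset.sum_apply, Finset.sum_pi_single, Finset.mem_Ico]
      split_ifs <;> omega)
    (fun x y h => by
      unfold sparseX at h
      simp only [Pi.neg_apply, Finset.sum_apply, Finset.sum_pi_single, Finset.mem_Ico]
      split_ifs <;> omega)
  simp only [Equiv.Perm.coe_one, Function.comp_id, map_neg, map_sum, zero_mul] at h
  rw [Finset.sum_congr rfl fun i hi => rowWeight_single_eq hk hn hF hm (j := 1)
      (by rw [Finset.mem_Ico] at hi; omega) (by omega),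
    Finset.sum_congr rfl fun i hi => colWeight_single_eq hk hn hF hm (j := b)
      (by rw [Finset.mem_Ico] at hi; omega) (by omega)] at h
  simp only [Finset.sum_const, Nat.card_Ico, nsmul_eq_mul, Nat.cast_sub (show 1 ≤ k by omega),
    Nat.cast_one, Nat.add_sub_cancel_left] at h
  linarith

lemma exists_rowWeight_eq_mul (hk : 2 ≤ k) (hn : k + b ≤ n) (hF : coreDet n k b = G * H) :
    ∃ m, MvPolynomial.coeff m G ≠ 0 ∧ ∃ e : ℕ, rowWeight m (Pi.single 1 1) = k * e ∧
      (e = 0 → IsUnit G) := by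
  have h := eval_coreDet_sparsePoint_ne_zero hk hn (σ := 1) (τ := 1) (fun _ _ => rfl)
    (fun _ _ => rfl)
  rw [hF, map_mul] at h
  obtain ⟨m, hm, hz⟩ := exists_coeff_ne_zero_of_eval_ne_zero (left_ne_zero_of_mul h)
  have hpencil := pencil_rowWeight_eq hk hn hF hm
  set p := rowWeight m (Pi.single 1 1)
  set s := colWeight m (Pi.single b 1) with hs
  have hp0 : 0 ≤ p := rowWeight_nonneg m (Pi.single_nonneg.mpr zero_le_one)
  have hpk : p = k * (p - s) := by linarith
  have he : 0 ≤ p - s := by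
    by_contra hneg
    have : (k : ℤ) * (p - s) < 0 := mul_neg_of_pos_of_neg (by omega) (by omega)
    omega
  refine ⟨m, hm, (p - s).toNat, by rwa [Int.toNat_of_nonneg he], fun h0 => ?_⟩
  have hps : p - s = 0 := by omega
  have hp : p = 0 := by rw [hpk, hps, mul_zero]
  have hs0 : s = 0 := by omega
  have hrow : ∀ i, 1 ≤ i → i < n → rowWeight m (Pi.single i 1) = 0 := by
    intro i h1 hin
    by_cases hi : i < k + b
    · rw [rowWeight_single_eq hk hn hF hm (j := 1) ⟨h1, hi⟩ (by omega)]
      exact hp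
    · rw [rowWeight_single_eq_colWeight_single hk hn hF hm (by omega),
        colWeight_single_eq hk hn hF hm (j := b) (by omega) (by omega)]
      exact hs0
  have hm0 : m = 0 := by
    by_contra hne
    obtain ⟨x, hx⟩ := Finsupp.support_nonempty_iff.mpr hne
    have hpos := rowWeight_single_pos hx
    have hzx := hz x hx
    obtain ⟨t, i, j⟩ := x
    simp only [sparsePoint, ne_eq, ite_eq_right_iff, one_ne_zero, imp_false, not_not] at hzx
    have hi : 1 ≤ i ∧ i < n := by
      rcases hzx with ⟨-, h⟩ | ⟨-, h⟩
      · rw [Equiv.Perm.coe_one, id_eq, sparseX] at h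
        omega
      · rw [Equiv.Perm.coe_one, id_eq, sparseY] at h
        omega
    rw [hrow i hi.1 hi.2] at hpos
    exact lt_irrefl _ hpos
  have hconst : G = MvPolynomial.C (MvPolynomial.coeff 0 G) := by
    ext d
    rw [MvPolynomial.coeff_C]
    split_ifs with hd
    · rw [hd]
    by_contra hcd
    have hw := weight_eq_of_coreDet_eq_mul hk hn hF 1 0 0 hcd hm
    subst hm0
    obtain ⟨x, hx⟩ := Finsupp.support_nonempty_iff.mpr (Ne.symm hd)
    have hpos := rowWeight_single_pos hx
    have hle := rowWeight_nonneg d (u := 1 - Pi.single x.2.1 1) fun i => by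
      simp only [Pi.zero_apply, Pi.sub_apply, Pi.one_apply, Pi.single_apply]
      split_ifs <;> norm_num
    rw [map_sub] at hle
    have h1 : rowWeight (0 : Bool × ℕ × ℕ →₀ ℕ) 1 = 0 := by simp [rowWeight_apply]
    simp only [map_zero, zero_mul, add_zero, h1] at hw
    omega
  rw [hconst]
  subst hm0
  exact (isUnit_iff_ne_zero.mpr hm).map MvPolynomial.C

end Factor

lemma coreDet_isWeightedHomogeneous_row_one {n k b : ℕ} (hk : 2 ≤ k) (hn : k + b ≤ n) :
    MvPolynomial.IsWeightedHomogeneous (entryWeight (Pi.single 1 1) 0 0) (coreDet n k b)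
      (k : ℤ) := by
  convert coreDet_isWeightedHomogeneous hk hn (Pi.single 1 1) 0 0 using 1
  obtain ⟨l, rfl⟩ : ∃ l, k = l + 1 := ⟨k - 1, by omega⟩
  obtain ⟨m, rfl⟩ : ∃ m, n = m + 1 := ⟨n - 1, by omega⟩
  have hm : 0 < m := by omega
  have hcount := Nat.count_modEq_card (l * (m + 1) + b) hm 0
  have hval : (l * (m + 1) + b) / m + (if 0 % m < (l * (m + 1) + b) % m then 1 else 0) = l + 1 := by
    rw [Nat.zero_mod, show l * (m + 1) + b = m * l + (l + b) by ring, Nat.mul_add_div hm,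
      Nat.mul_add_mod]
    rcases (show l + b ≤ m by omega).eq_or_lt with h | h
    · simp [h, hm]
    · rw [Nat.div_eq_of_lt h, Nat.mod_eq_of_lt h, if_pos (by omega)]
  rw [hval, Nat.count_eq_card_filter_range] at hcount
  simp only [Nat.add_sub_cancel, Pi.single_apply, Pi.zero_apply, zero_mul, add_zero, sub_zero,
    Finset.sum_const_zero, Finset.sum_boole]
  rw [← hcount]
  congr 2
  refine Finset.filter_congr fun r _ => ?_
  simp [Nat.ModEq]

/-- the core determinant of the generic staircase pair is irreducible. -/
theorem statement9 (n k b : ℕ) (hk : 2 ≤ k) (hn : k + b ≤ n) :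
    Irreducible
      (sminor (stairCore n k (genX n (k + b) b) (genY n (k + b) b)) 1 ((k - 1) * n + b)) := by
  have hdeg := coreDet_isWeightedHomogeneous_row_one hk hn
  have hne := coreDet_ne_zero hk hn
  change Irreducible (coreDet n k b)
  refine ⟨fun hu => ?_, fun G H hF => ?_⟩
  · obtain ⟨c, -, hc⟩ := MvPolynomial.isUnit_iff_eq_C_of_isReduced.mp hu
    have h0 := MvPolynomial.isWeightedHomogeneous_C (entryWeight (Pi.single 1 1) 0 0) c
    rw [← hc] at h0
    have := hdeg.inj_right hne h0
    omega
  · have hF' : coreDet n k b = H * G := by rw [hF, mul_comm]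
    obtain ⟨m, hm, e, he, heu⟩ := exists_rowWeight_eq_mul hk hn hF
    obtain ⟨m', hm', e', he', heu'⟩ := exists_rowWeight_eq_mul hk hn hF'
    have hG : MvPolynomial.IsWeightedHomogeneous (entryWeight (Pi.single 1 1) 0 0) G
        (k * e : ℤ) := fun d hd => by
      have := weight_eq_of_coreDet_eq_mul hk hn hF (Pi.single 1 1) 0 0 hd hm
      rw [weight_entryWeight, this, he]
      simp
    have hH : MvPolynomial.IsWeightedHomogeneous (entryWeight (Pi.single 1 1) 0 0) H
        (k * e' : ℤ) := fun d hd => by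
      have := weight_eq_of_coreDet_eq_mul hk hn hF' (Pi.single 1 1) 0 0 hd hm'
      rw [weight_entryWeight, this, he']
      simp
    have hmul := hG.mul hH
    rw [← hF] at hmul
    have hk_eq := hdeg.inj_right hne hmul
    have hsum : e + e' = 1 := by
      have h1 : k * (e + e') = k * 1 := by
        rw [mul_add, mul_one]
        exact_mod_cast hk_eq.symm
      exact Nat.eq_of_mul_eq_mul_left (by omega) h1
    rcases Nat.eq_zero_or_pos e with h | h
    · exact Or.inl (heu h)
    · exact Or.inr (heu' (by omega))

end
end

section
/- Specialize the staircase setting to a = n, b = 0 (so k = n, n ≥ 2): X and Y are generic n×n matrices whose 2n² entries are independent indeterminates, and the core Φ has size N = n(n−1). Then for every 1 ≤ i ≤ N − n + 1, the trailing minor φ_i = det Φ_{[i,N]}^{[i,N]} is an irreducible element of the polynomial ring R = ℂ[x_{11},…,x_{nn}, y_{11},…,y_{nn}]. -/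
open Matrix Finset

noncomputable section

section LowestForms

open MvPolynomial
open Finsupp (weight single)

variable {σ K : Type*} [Field K]

/-- Lowest weighted homogeneous components are multiplicative. -/
lemma weightedHomogeneousComponent_mul_of_le_weight {w : σ → ℕ} {g h : MvPolynomial σ K}
    {k l : ℕ} (hg : ∀ d ∈ g.support, k ≤ weight w d) (hh : ∀ d ∈ h.support, l ≤ weight w d) :
    weightedHomogeneousComponent w (k + l) (g * h) =
      weightedHomogeneousComponent w k g * weightedHomogeneousComponent w l h := by
  classical
  ext d
  rw [coeff_weightedHomogeneousComponent]
  split_ifs with hd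
  · rw [coeff_mul, coeff_mul]
    refine Finset.sum_congr rfl fun x hx => ?_
    rw [HasAntidiagonal.mem_antidiagonal] at hx
    rw [← hx, map_add] at hd
    simp only [coeff_weightedHomogeneousComponent]
    by_cases h1 : coeff x.1 g = 0
    · simp [h1]
    by_cases h2 : coeff x.2 h = 0
    · simp [h2]
    have h3 := hg _ (mem_support_iff.2 h1)
    have h4 := hh _ (mem_support_iff.2 h2)
    rw [if_pos (by omega), if_pos (by omega)]
  · exact (((weightedHomogeneousComponent_isWeightedHomogeneous k g).mul
      (weightedHomogeneousComponent_isWeightedHomogeneous l h)).coeff_eq_zero d hd).symm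

lemma exists_weightedHomogeneousComponent_ne_zero (w : σ → ℕ) {g : MvPolynomial σ K}
    (hg : g ≠ 0) : ∃ k, (∀ d ∈ g.support, k ≤ weight w d) ∧
      weightedHomogeneousComponent w k g ≠ 0 := by
  classical
  obtain ⟨d, hd, hmin⟩ := g.support.exists_min_image (weight w) (support_nonempty.2 hg)
  refine ⟨weight w d, hmin, fun h0 => ?_⟩
  have := congrArg (coeff d) h0
  rw [coeff_weightedHomogeneousComponent, if_pos rfl] at this
  exact mem_support_iff.1 hd (by simpa using this)

/-- The lowest form of a product is the product of the lowest forms of the factors. -/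
lemma exists_lowest_factors {w : σ → ℕ} {g h : MvPolynomial σ K} {n : ℕ}
    (hn : weightedHomogeneousComponent w n (g * h) ≠ 0)
    (hlow : ∀ d ∈ (g * h).support, n ≤ weight w d) :
    ∃ k l, (∀ d ∈ g.support, k ≤ weight w d) ∧ (∀ d ∈ h.support, l ≤ weight w d) ∧
      k + l = n ∧ weightedHomogeneousComponent w k g * weightedHomogeneousComponent w l h =
        weightedHomogeneousComponent w n (g * h) := by
  classical
  have hgh : g * h ≠ 0 := fun h0 => hn (by rw [h0, map_zero])
  obtain ⟨k, hk, hk0⟩ :=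
    exists_weightedHomogeneousComponent_ne_zero w (left_ne_zero_of_mul hgh)
  obtain ⟨l, hl, hl0⟩ :=
    exists_weightedHomogeneousComponent_ne_zero w (right_ne_zero_of_mul hgh)
  have hmul := weightedHomogeneousComponent_mul_of_le_weight hk hl
  have hkl : k + l = n := by
    apply le_antisymm
    · obtain ⟨d, hd⟩ := ne_zero_iff.1 hn
      rw [coeff_weightedHomogeneousComponent] at hd
      split_ifs at hd with hdw
      · obtain ⟨a, ha, b, hb, rfl⟩ :=
          Finset.mem_add.1 (support_mul g h (mem_support_iff.2 hd))
        rw [map_add] at hdw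
        have := hk a ha
        have := hl b hb
        omega
      · exact absurd rfl hd
    · have hne : weightedHomogeneousComponent w (k + l) (g * h) ≠ 0 := by
        rw [hmul]; exact mul_ne_zero hk0 hl0
      obtain ⟨d, hd⟩ := ne_zero_iff.1 hne
      rw [coeff_weightedHomogeneousComponent] at hd
      split_ifs at hd with hdw
      · rw [← hdw]; exact hlow d (mem_support_iff.2 hd)
      · exact absurd rfl hd
  exact ⟨k, l, hk, hl, hkl, by rw [← hmul, hkl]⟩

lemma coeff_ne_zero_of_coeff_weightedHomogeneousComponent {w : σ → ℕ} {g : MvPolynomial σ K}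
    {k : ℕ} {d : σ →₀ ℕ} (hd : coeff d (weightedHomogeneousComponent w k g) ≠ 0) :
    coeff d g ≠ 0 := by
  classical
  rw [coeff_weightedHomogeneousComponent] at hd
  split_ifs at hd
  · exact hd
  · exact absurd rfl hd

lemma weightedHomogeneousComponent_sum {ι : Type*} [Fintype ι] {w : σ → ℕ}
    {t : ι → MvPolynomial σ K} {F : ι → ℕ} (ht : ∀ i, IsWeightedHomogeneous w (t i) (F i))
    (n : ℕ) : weightedHomogeneousComponent w n (∑ i, t i) = ∑ i with F i = n, t i := by
  rw [map_sum, Finset.sum_filter]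
  refine Finset.sum_congr rfl fun i _ => ?_
  split_ifs with h
  · rw [← h, (ht i).weightedHomogeneousComponent_same]
  · exact (ht i).weightedHomogeneousComponent_ne n (Ne.symm h)

lemma le_weight_of_mem_support_sum {ι : Type*} [Fintype ι] {w : σ → ℕ}
    {t : ι → MvPolynomial σ K} {F : ι → ℕ} (ht : ∀ i, IsWeightedHomogeneous w (t i) (F i))
    {n : ℕ} (hn : ∀ i, t i ≠ 0 → n ≤ F i) : ∀ d ∈ (∑ i, t i).support, n ≤ weight w d := by
  intro d hd
  rw [mem_support_iff, coeff_sum] at hd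
  obtain ⟨i, -, hi⟩ := Finset.exists_ne_zero_of_sum_ne_zero hd
  rw [ht i hi]
  exact hn i fun h => hi (by rw [h, coeff_zero])

/-- If the lowest form of `g * h` is a monomial, the exponent of this monomial decomposes in only
one way as a sum of exponents of monomials of `g` and of `h`. -/
lemma exists_unique_exponents_of_lowest_monomial {w : σ → ℕ} {g h : MvPolynomial σ K} {n : ℕ}
    {D : σ →₀ ℕ} (hn : weightedHomogeneousComponent w n (g * h) = monomial D 1)
    (hlow : ∀ d ∈ (g * h).support, n ≤ weight w d) :
    ∃ a b, a ∈ g.support ∧ b ∈ h.support ∧ a + b = D ∧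
      ∀ a' ∈ g.support, ∀ b' ∈ h.support, a' + b' = D → a' = a ∧ b' = b := by
  classical
  obtain ⟨k, l, hk, hl, hkl, hmul⟩ := exists_lowest_factors (by simp [hn]) hlow
  rw [hn] at hmul
  obtain ⟨a, α, -, hα, hga⟩ := dvd_monomial_one_iff_exists.1 (Dvd.intro _ hmul)
  obtain ⟨b, β, -, hβ, hhb⟩ := dvd_monomial_one_iff_exists.1 (Dvd.intro_left _ hmul)
  have hag : coeff a (weightedHomogeneousComponent w k g) ≠ 0 := by
    rw [hga, coeff_monomial, if_pos rfl]; exact hα.ne_zero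
  have hbh : coeff b (weightedHomogeneousComponent w l h) ≠ 0 := by
    rw [hhb, coeff_monomial, if_pos rfl]; exact hβ.ne_zero
  have hab : a + b = D := by
    rw [hga, hhb, monomial_mul] at hmul
    rcases (monomial_eq_monomial_iff _ _ _ _).1 hmul with h | h
    · exact h.1
    · exact absurd h.2 one_ne_zero
  have hwa : weight w a = k := by
    by_contra hne
    rw [coeff_weightedHomogeneousComponent, if_neg hne] at hag
    exact hag rfl
  have hwb : weight w b = l := by
    by_contra hne
    rw [coeff_weightedHomogeneousComponent, if_neg hne] at hbh
    exact hbh rfl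
  refine ⟨a, b, mem_support_iff.2 (coeff_ne_zero_of_coeff_weightedHomogeneousComponent hag),
    mem_support_iff.2 (coeff_ne_zero_of_coeff_weightedHomogeneousComponent hbh), hab, ?_⟩
  intro a' ha' b' hb' hab'
  have h1 := hk a' ha'
  have h2 := hl b' hb'
  have h3 : weight w a' + weight w b' = weight w a + weight w b := by
    rw [← map_add, ← map_add, hab, hab']
  have h4 : a' = a := by
    have : coeff a' (weightedHomogeneousComponent w k g) ≠ 0 := by
      rw [coeff_weightedHomogeneousComponent, if_pos (by omega)]
      exact mem_support_iff.1 ha'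
    rw [hga, coeff_monomial] at this
    by_contra hne
    exact this (if_neg (Ne.symm hne))
  refine ⟨h4, ?_⟩
  rw [h4, ← hab] at hab'
  exact add_left_cancel hab'

lemma irreducible_X_mul_X_sub_X_mul_X {a b y z : σ} (hay : a ≠ y) (haz : a ≠ z) (hby : b ≠ y)
    (hbz : b ≠ z) (hab : a ≠ b) :
    Irreducible (X a * X b - X y * X z : MvPolynomial σ K) := by
  classical
  rw [sub_eq_add_neg]
  refine irreducible_mul_X_add _ _ b (X_ne_zero a) (by simpa [vars_X] using hab.symm) ?_ ?_
  · rw [vars_neg]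
    intro hb
    have := vars_mul _ _ hb
    simp [vars_X, hby, hbz] at this
  · rw [IsRelPrime.neg_right_iff]
    have key : ∀ c : σ, a ≠ c → IsRelPrime (X a : MvPolynomial σ K) (X c) := fun c hc =>
      ((X_prime (R := K) (i := a)).irreducible.isRelPrime_iff_not_dvd).2 fun hd => by
        exact hc (X_dvd_X.1 hd)
    exact (key y hay).mul_right (key z haz)

lemma exists_exponents_of_dvd_lowest {w : σ → ℕ} {g h : MvPolynomial σ K} {k l : ℕ}
    {Q : σ →₀ ℕ} {a b y z : σ} (hay : a ≠ y) (haz : a ≠ z)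
    (hmul : weightedHomogeneousComponent w k g * weightedHomogeneousComponent w l h =
      monomial Q 1 * (X a * X b - X y * X z))
    (hdvd : (X a * X b - X y * X z : MvPolynomial σ K) ∣ weightedHomogeneousComponent w k g)
    (hB : (X a * X b - X y * X z : MvPolynomial σ K) ≠ 0) :
    ∃ a' ∈ g.support, ∃ b' ∈ h.support, a' + b' = Q + single a 1 + single b 1 ∧ b' ≤ Q := by
  classical
  obtain ⟨r, hr⟩ := hdvd
  have hrQ : r * weightedHomogeneousComponent w l h = monomial Q 1 := by
    apply mul_left_cancel₀ hB
    rw [← mul_assoc, ← hr, hmul, mul_comm]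
  obtain ⟨u, α, -, hα, hu⟩ := dvd_monomial_one_iff_exists.1 (Dvd.intro _ hrQ)
  obtain ⟨v, β, hvQ, hβ, hv⟩ := dvd_monomial_one_iff_exists.1 (Dvd.intro_left _ hrQ)
  have huv : u + v = Q := by
    rw [hu, hv, monomial_mul] at hrQ
    rcases (monomial_eq_monomial_iff _ _ _ _).1 hrQ with h | h
    · exact h.1
    · exact absurd h.2 one_ne_zero
  refine ⟨u + single a 1 + single b 1, mem_support_iff.2
    (coeff_ne_zero_of_coeff_weightedHomogeneousComponent (w := w) (k := k) ?_), v,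
    mem_support_iff.2 (coeff_ne_zero_of_coeff_weightedHomogeneousComponent (w := w) (k := l) ?_),
    by rw [← huv]; abel, hvQ⟩
  · rw [hr, hu, sub_mul, coeff_sub]
    simp only [X, monomial_mul, coeff_monomial, one_mul]
    rw [if_pos (by abel), if_neg, sub_zero]
    · exact hα.ne_zero
    · intro he
      have := DFunLike.congr_fun he a
      simp only [Finsupp.add_apply, Finsupp.single_apply, hay.symm, haz.symm, if_true,
        if_false] at this
      split_ifs at this <;> omega
  · rw [hv, coeff_monomial, if_pos rfl]; exact hβ.ne_zero


/-- The weight `t ^ 2 + N` of a variable of index `t`, lowered to `t ^ 2` when `t ∈ S`. -/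
def indexWeight (idx : σ → ℤ) (N : ℕ) (S : Finset ℤ) (τ : σ) : ℕ :=
  (idx τ ^ 2 + N - N * (if idx τ ∈ S then 1 else 0)).toNat

lemma natCast_indexWeight (idx : σ → ℤ) (N : ℕ) (S : Finset ℤ) (τ : σ) :
    (indexWeight idx N S τ : ℤ) = idx τ ^ 2 + N - N * (if idx τ ∈ S then 1 else 0) := by
  apply Int.toNat_of_nonneg
  split_ifs
  · nlinarith [sq_nonneg (idx τ)]
  · nlinarith [sq_nonneg (idx τ)]

lemma sum_sq_perm {M : ℕ} (m : ℤ) (π : Equiv.Perm (Fin M)) :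
    ∑ i, ((m + 1) * (π i : ℤ) - m * (i : ℤ)) ^ 2 =
      ∑ i : Fin M, (i : ℤ) ^ 2 + m * (m + 1) * ∑ i, ((π i : ℤ) - i) ^ 2 := by
  have h := Equiv.sum_comp π fun i : Fin M => (i : ℤ) ^ 2
  have key : ∀ i, ((m + 1) * (π i : ℤ) - m * (i : ℤ)) ^ 2 =
      (m + 1) * (π i : ℤ) ^ 2 - m * (i : ℤ) ^ 2 + m * (m + 1) * ((π i : ℤ) - i) ^ 2 := by
    intro i; ring
  simp only [key, Finset.sum_add_distrib, Finset.sum_sub_distrib, ← Finset.mul_sum]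
  rw [h]; ring

/-- The relative cost, in `indexWeight`, of using column `i` off the diagonal. -/
def moveCost {M : ℕ} (m : ℤ) (S : Finset ℤ) (π : Equiv.Perm (Fin M)) (i : Fin M) : ℤ :=
  ((π i : ℤ) - i) ^ 2 - (if (m + 1) * (π i : ℤ) - m * (i : ℤ) ∈ S then 1 else 0) +
    (if (i : ℤ) ∈ S then 1 else 0)

lemma moveCost_nonneg {M : ℕ} (m : ℤ) (S : Finset ℤ) (π : Equiv.Perm (Fin M)) (i : Fin M) :
    0 ≤ moveCost m S π i := by
  unfold moveCost
  by_cases h : (π i : ℤ) = i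
  · rw [h, show (m + 1) * (i : ℤ) - m * i = i by ring]; simp
  · have : 0 < ((π i : ℤ) - i) ^ 2 := by
      have := sub_ne_zero.2 h
      positivity
    split_ifs <;> omega

lemma sq_eq_one_of_moveCost_eq_zero {M : ℕ} {m : ℤ} {S : Finset ℤ} {π : Equiv.Perm (Fin M)}
    {i : Fin M} (h0 : moveCost m S π i = 0) (hne : π i ≠ i) :
    ((π i : ℤ) = i + 1 ∨ (π i : ℤ) = i - 1) ∧ (m + 1) * (π i : ℤ) - m * (i : ℤ) ∈ S := by
  unfold moveCost at h0
  have hne' : (π i : ℤ) - i ≠ 0 := by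
    intro h
    apply hne
    ext
    omega
  have hpos : 0 < ((π i : ℤ) - i) ^ 2 := by positivity
  have hS : (m + 1) * (π i : ℤ) - m * (i : ℤ) ∈ S := by
    by_contra hS
    rw [if_neg hS] at h0
    split_ifs at h0 <;> omega
  refine ⟨?_, hS⟩
  rw [if_pos hS] at h0
  have h1 : ((π i : ℤ) - i) ^ 2 = 1 := by split_ifs at h0 <;> omega
  rw [sq] at h1
  rcases mul_self_eq_one_iff.1 h1 with h | h
  · left; omega
  · right; omega

lemma eq_one_of_moveCost_empty {M : ℕ} {m : ℤ} {π : Equiv.Perm (Fin M)}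
    (h : ∀ i, moveCost m ∅ π i = 0) : π = 1 := by
  ext i
  by_contra hne
  have := (sq_eq_one_of_moveCost_eq_zero (h i) fun h' => hne (by simp [h'])).2
  simp at this

lemma eq_one_or_swap_of_moveCost_pair {M : ℕ} {m : ℤ} (hm : 1 ≤ m) {π : Equiv.Perm (Fin M)}
    {i₀ i₁ : Fin M} (hi : (i₁ : ℕ) = i₀ + 1)
    (h : ∀ i, moveCost m {(i₀ : ℤ) - m, (i₀ : ℤ) + 1 + m} π i = 0) :
    π = 1 ∨ π = Equiv.swap i₀ i₁ := by
  have step : ∀ i, π i ≠ i →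
      ((π i : ℤ) = i + 1 ∧ ((i : ℤ) = i₀ ∨ (i : ℤ) = i₀ - 2 * m - 1)) ∨
      ((π i : ℤ) = i - 1 ∧ ((i : ℤ) = i₀ + 1 ∨ (i : ℤ) = i₀ + 2 * m + 2)) := by
    intro i hne
    obtain ⟨h1 | h1, h2⟩ := sq_eq_one_of_moveCost_eq_zero (h i) hne
    · left
      refine ⟨h1, ?_⟩
      rw [h1, show (m + 1) * ((i : ℤ) + 1) - m * i = i + 1 + m by ring] at h2
      simp only [Finset.mem_insert, Finset.mem_singleton] at h2
      omega
    · right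
      refine ⟨h1, ?_⟩
      rw [h1, show (m + 1) * ((i : ℤ) - 1) - m * i = i - 1 - m by ring] at h2
      simp only [Finset.mem_insert, Finset.mem_singleton] at h2
      omega
  have moved : ∀ i, π i ≠ i → π (π i) ≠ π i := fun i hne h' => hne (π.injective h')
  have hmove : ∀ i, π i ≠ i → (i = i₀ ∧ π i = i₁) ∨ (i = i₁ ∧ π i = i₀) := by
    intro i hne
    have h1 := step i hne
    have h2 := step (π i) (moved i hne)
    simp only [Fin.ext_iff]
    omega
  by_cases h0 : π i₀ = i₀
  · left
    ext i
    by_contra hne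
    have hne' : π i ≠ i := fun h' => hne (by simp [h'])
    rcases hmove i hne' with ⟨rfl, -⟩ | ⟨rfl, h2⟩
    · exact hne' h0
    · have := moved _ hne'
      rw [h2] at this
      exact this h0
  · right
    have h01 : π i₀ = i₁ := by
      rcases hmove i₀ h0 with h' | h'
      · exact h'.2
      · rw [Fin.ext_iff] at h'; omega
    have h10 : π i₁ = i₀ := by
      have h1 := moved _ h0
      rw [h01] at h1
      rcases hmove i₁ h1 with h' | h'
      · rw [Fin.ext_iff] at h'; omega
      · exact h'.2
    apply Equiv.ext
    intro i
    by_cases hi0 : i = i₀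
    · rw [hi0, h01, Equiv.swap_apply_left]
    by_cases hi1 : i = i₁
    · rw [hi1, h10, Equiv.swap_apply_right]
    rw [Equiv.swap_apply_of_ne_of_ne hi0 hi1]
    by_contra hne
    rcases hmove i hne with h' | h'
    · exact hi0 h'.1
    · exact hi1 h'.1

section Determinant

variable {M : ℕ} (c : Fin M → Fin M → K) (v : Fin M → Fin M → σ)

/-- The term of a permutation in the Leibniz expansion. -/
def leibnizTerm (π : Equiv.Perm (Fin M)) : MvPolynomial σ K :=
  ((Equiv.Perm.sign π : ℤ) : MvPolynomial σ K) * ∏ i, (C (c (π i) i) * X (v (π i) i))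

lemma det_eq_sum_leibnizTerm :
    (Matrix.of fun p q => (C (c p q) * X (v p q) : MvPolynomial σ K)).det =
      ∑ π, leibnizTerm c v π := by
  rw [Matrix.det_apply']
  rfl

lemma isWeightedHomogeneous_leibnizTerm (w : σ → ℕ) (π : Equiv.Perm (Fin M)) :
    IsWeightedHomogeneous w (leibnizTerm c v π) (∑ i, w (v (π i) i)) := by
  have h := IsWeightedHomogeneous.prod Finset.univ
    (fun i => (C (c (π i) i) * X (v (π i) i) : MvPolynomial σ K)) (fun i => w (v (π i) i))
    (w := w) fun i _ => (isWeightedHomogeneous_X K w (v (π i) i)).C_mul _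
  have := h.C_mul (((Equiv.Perm.sign π : ℤ)) : K)
  rwa [map_intCast] at this

variable {c v} {idx : σ → ℤ} {m : ℕ}

lemma sum_indexWeight (hidx : ∀ p q, c p q ≠ 0 → idx (v p q) = (m + 1) * (p : ℤ) - m * (q : ℤ))
    (hdiag : ∀ p, c p p = 1) (S : Finset ℤ) {π : Equiv.Perm (Fin M)}
    (hπ : leibnizTerm c v π ≠ 0) :
    ((∑ i, indexWeight idx (m * (m + 1)) S (v (π i) i) : ℕ) : ℤ) =
      ((∑ i, indexWeight idx (m * (m + 1)) S (v i i) : ℕ) : ℤ) +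
        m * (m + 1) * ∑ i, moveCost m S π i := by
  have hc : ∀ i, idx (v (π i) i) = (m + 1) * (π i : ℤ) - m * (i : ℤ) := by
    intro i
    apply hidx
    intro h0
    apply hπ
    rw [leibnizTerm, Finset.prod_eq_zero (Finset.mem_univ i) (by rw [h0]; simp), mul_zero]
  have hd : ∀ i, idx (v i i) = (i : ℤ) := by
    intro i
    rw [hidx i i (by rw [hdiag]; exact one_ne_zero)]; ring
  push_cast
  simp only [natCast_indexWeight, hc, hd, moveCost, Finset.sum_add_distrib,
    Finset.sum_sub_distrib, ← Finset.mul_sum, sum_sq_perm]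
  push_cast
  ring

/-- The lowest form of the determinant is the sum over the permutations of zero cost. -/
lemma lowest_form_det (hm : 1 ≤ m)
    (hidx : ∀ p q, c p q ≠ 0 → idx (v p q) = (m + 1) * (p : ℤ) - m * (q : ℤ))
    (hdiag : ∀ p, c p p = 1) (S : Finset ℤ) (T : Finset (Equiv.Perm (Fin M)))
    (hT : ∀ π, (∀ i, moveCost m S π i = 0) → π ∈ T)
    (hT' : ∀ π ∈ T, leibnizTerm c v π ≠ 0 ∧ ∀ i, moveCost m S π i = 0) :
    ∃ n, (∀ d ∈ (∑ π, leibnizTerm c v π).support,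
        n ≤ weight (indexWeight idx (m * (m + 1)) S) d) ∧
      weightedHomogeneousComponent (indexWeight idx (m * (m + 1)) S) n
        (∑ π, leibnizTerm c v π) = ∑ π ∈ T, leibnizTerm c v π := by
  have hN : (0 : ℤ) < m * (m + 1) := by positivity
  refine ⟨∑ i, indexWeight idx (m * (m + 1)) S (v i i), ?_, ?_⟩
  · refine le_weight_of_mem_support_sum
      (fun π => isWeightedHomogeneous_leibnizTerm c v _ π) fun π hπ => ?_
    have h := sum_indexWeight hidx hdiag S hπ
    have h' : 0 ≤ ∑ i, moveCost m S π i := Finset.sum_nonneg fun i _ => moveCost_nonneg _ _ _ _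
    have := mul_nonneg hN.le h'
    omega
  · rw [weightedHomogeneousComponent_sum
      (fun π => isWeightedHomogeneous_leibnizTerm c v _ π)]
    symm
    apply Finset.sum_subset
    · intro π hπ
      obtain ⟨h1, h2⟩ := hT' π hπ
      have h := sum_indexWeight hidx hdiag S h1
      rw [Finset.sum_eq_zero fun i _ => h2 i, mul_zero, add_zero] at h
      simp only [Finset.mem_filter, Finset.mem_univ, true_and]
      exact_mod_cast h
    · intro π hπ hπT
      by_contra hne
      apply hπT
      apply hT
      have h := sum_indexWeight hidx hdiag S hne
      rw [(Finset.mem_filter.1 hπ).2, left_eq_add] at h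
      have h0 := (mul_eq_zero.1 h).resolve_left hN.ne'
      have := (Finset.sum_eq_zero_iff_of_nonneg fun i _ => moveCost_nonneg (m : ℤ) S π i).1 h0
      exact fun i => this i (Finset.mem_univ i)


lemma prod_X_eq_monomial {ι : Type*} (s : Finset ι) (u : ι → σ) :
    ∏ i ∈ s, (X (u i) : MvPolynomial σ K) = monomial (∑ i ∈ s, single (u i) 1) 1 := by
  rw [monomial_sum_one]
  rfl

lemma leibnizTerm_one (hdiag : ∀ p, c p p = 1) :
    leibnizTerm c v 1 = monomial (∑ i, single (v i i) 1) 1 := by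
  simp [leibnizTerm, hdiag, prod_X_eq_monomial]

lemma prod_eq_prod_sdiff_pair {R : Type*} [CommMonoid R] {i₀ i₁ : Fin M} (h : i₀ ≠ i₁)
    (f : Fin M → R) : ∏ i, f i = (∏ i ∈ Finset.univ \ {i₀, i₁}, f i) * (f i₀ * f i₁) := by
  rw [← Finset.prod_pair h, Finset.prod_sdiff (Finset.subset_univ _)]

lemma leibnizTerm_one_eq_mul (hdiag : ∀ p, c p p = 1) {i₀ i₁ : Fin M} (h : i₀ ≠ i₁) :
    leibnizTerm c v 1 = monomial (∑ i ∈ Finset.univ \ {i₀, i₁}, single (v i i) 1) 1 *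
      (X (v i₀ i₀) * X (v i₁ i₁)) := by
  rw [← prod_X_eq_monomial, leibnizTerm, prod_eq_prod_sdiff_pair h]
  simp [hdiag]

lemma leibnizTerm_swap (hdiag : ∀ p, c p p = 1) {i₀ i₁ : Fin M} (h : i₀ ≠ i₁)
    (h01 : c i₀ i₁ = 1) (h10 : c i₁ i₀ = 1) :
    leibnizTerm c v (Equiv.swap i₀ i₁) =
      -(monomial (∑ i ∈ Finset.univ \ {i₀, i₁}, single (v i i) 1) 1 *
        (X (v i₁ i₀) * X (v i₀ i₁))) := by
  rw [← prod_X_eq_monomial, leibnizTerm, prod_eq_prod_sdiff_pair h, Equiv.Perm.sign_swap h]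
  have : ∀ i ∈ Finset.univ \ {i₀, i₁}, (C (c (Equiv.swap i₀ i₁ i) i) *
      X (v (Equiv.swap i₀ i₁ i) i) : MvPolynomial σ K) = X (v i i) := by
    intro i hi
    simp only [Finset.mem_sdiff, Finset.mem_univ, true_and, Finset.mem_insert,
      Finset.mem_singleton, not_or] at hi
    rw [Equiv.swap_apply_of_ne_of_ne hi.1 hi.2, hdiag, C_1, one_mul]
  rw [Finset.prod_congr rfl this]
  simp [h01, h10]

lemma isUnit_of_full_degree {g h : MvPolynomial σ K} {D : σ →₀ ℕ} (hgh : g * h ≠ 0)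
    (hD : D ∈ g.support) (hdeg : (g * h).totalDegree ≤ D.degree) : IsUnit h := by
  have hh := right_ne_zero_of_mul hgh
  rw [totalDegree_mul_of_isDomain (left_ne_zero_of_mul hgh) hh] at hdeg
  have h1 : D.degree ≤ g.totalDegree := le_totalDegree hD
  have h0 := totalDegree_eq_zero_iff_eq_C.1 (show h.totalDegree = 0 by omega)
  rw [h0] at hh ⊢
  exact (isUnit_iff_ne_zero.2 fun hc => hh (by rw [hc, C_0])).map C

/-- A determinant with entries `0` or variables, in which the variable at position `(p, q)`, if
any, has index `(m + 1) * p - m * q` and all entries near the diagonal are nonzero, is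
irreducible. -/
theorem irreducible_det_of_index (hm : 1 ≤ m) (hM : 0 < M)
    (hidx : ∀ p q, c p q ≠ 0 → idx (v p q) = (m + 1) * (p : ℤ) - m * (q : ℤ))
    (hnear : ∀ p q : Fin M, (p : ℕ) ≤ q + 1 → (q : ℕ) ≤ p + 1 → c p q = 1) :
    Irreducible (Matrix.of fun p q => (C (c p q) * X (v p q) : MvPolynomial σ K)).det := by
  classical
  rw [det_eq_sum_leibnizTerm]
  have hdiag : ∀ p, c p p = 1 := fun p => hnear p p (by omega) (by omega)
  have hidx' : ∀ p q : Fin M, (p : ℕ) ≤ q + 1 → (q : ℕ) ≤ p + 1 →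
      idx (v p q) = (m + 1) * (p : ℤ) - m * (q : ℤ) := fun p q h1 h2 =>
    hidx p q (by rw [hnear p q h1 h2]; exact one_ne_zero)
  have hd : ∀ i, idx (v i i) = (i : ℤ) := by
    intro i
    rw [hidx' i i (by omega) (by omega)]; ring
  have hinj : ∀ i j, v i i = v j j → i = j := by
    intro i j hij
    have := congrArg idx hij
    rw [hd, hd] at this
    ext
    exact_mod_cast this
  set D : σ →₀ ℕ := ∑ i, single (v i i) 1 with hDdef
  have hDi : ∀ s : Finset (Fin M), ∀ i,
      (∑ j ∈ s, single (v j j) 1 : σ →₀ ℕ) (v i i) = if i ∈ s then 1 else 0 := by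
    intro s i
    rw [Finsupp.finsetSum_apply]
    simp only [Finsupp.single_apply]
    rw [← Finset.sum_ite_eq' s i (fun _ => 1)]
    refine Finset.sum_congr rfl fun j _ => ?_
    by_cases hj : j = i
    · simp [hj]
    · rw [if_neg hj, if_neg fun h' => hj (hinj _ _ h')]
  have hD1 : leibnizTerm c v 1 = monomial D 1 := leibnizTerm_one hdiag
  have hDdeg : D.degree = M := by
    rw [hDdef, map_sum]
    simp
  have hcost1 : ∀ (S : Finset ℤ) (i : Fin M), moveCost (m : ℤ) S 1 i = 0 := by
    intro S i
    unfold moveCost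
    rw [Equiv.Perm.one_apply, show ((m : ℤ) + 1) * (i : ℤ) - m * i = i by ring]
    simp
  obtain ⟨n, hlow, hn⟩ := lowest_form_det (c := c) (v := v) (idx := idx) hm hidx hdiag ∅ {1}
    (fun π hπ => Finset.mem_singleton.2 (eq_one_of_moveCost_empty hπ))
    (fun π hπ => by
      rw [Finset.mem_singleton.1 hπ]
      exact ⟨by rw [hD1]; simp, hcost1 _⟩)
  rw [Finset.sum_singleton, hD1] at hn
  have htot : (∑ π, leibnizTerm c v π).totalDegree ≤ D.degree := by
    rw [hDdeg]
    refine IsHomogeneous.totalDegree_le (IsHomogeneous.sum _ _ _ fun π _ => ?_)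
    have := isWeightedHomogeneous_leibnizTerm c v (1 : σ → ℕ) π
    simpa [IsHomogeneous] using this
  have hDmem : D ∈ (∑ π, leibnizTerm c v π).support := by
    rw [mem_support_iff]
    apply coeff_ne_zero_of_coeff_weightedHomogeneousComponent
      (w := indexWeight idx (m * (m + 1)) ∅) (k := n)
    rw [hn]; simp
  have hf0 : ∑ π, leibnizTerm c v π ≠ 0 := by
    intro h0; rw [h0] at hDmem; simp at hDmem
  refine ⟨fun hu => ?_, ?_⟩
  · have h0 := (isUnit_iff_totalDegree_of_isReduced.1 hu).2
    have h1 : D.degree ≤ (∑ π, leibnizTerm c v π).totalDegree := le_totalDegree hDmem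
    omega
  intro g h hgh
  rw [hgh] at hlow hn htot hf0
  obtain ⟨a, b, ha, hb, hab, huniq⟩ := exists_unique_exponents_of_lowest_monomial hn hlow
  have hstep : ∀ i₀ i₁ : Fin M, (i₁ : ℕ) = i₀ + 1 →
      (a (v i₀ i₀) = 0 ∧ a (v i₁ i₁) = 0) ∨ (b (v i₀ i₀) = 0 ∧ b (v i₁ i₁) = 0) := by
    intro i₀ i₁ hi
    have hne : i₀ ≠ i₁ := fun h' => by rw [h'] at hi; omega
    have e00 := hd i₀
    have e11 := hd i₁
    have e01 := hidx' i₀ i₁ (by omega) (by omega)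
    have e10 := hidx' i₁ i₀ (by omega) (by omega)
    have hic : ((i₁ : ℕ) : ℤ) = (i₀ : ℕ) + 1 := by exact_mod_cast hi
    rw [hic] at e11 e01 e10
    rw [show ((m : ℤ) + 1) * (i₀ : ℤ) - m * ((i₀ : ℤ) + 1) = i₀ - m by ring] at e01
    rw [show ((m : ℤ) + 1) * ((i₀ : ℤ) + 1) - m * (i₀ : ℤ) = i₀ + 1 + m by ring] at e10
    have n1 : v i₀ i₀ ≠ v i₁ i₀ := fun h' => by rw [h'] at e00; omega
    have n2 : v i₀ i₀ ≠ v i₀ i₁ := fun h' => by rw [h'] at e00; omega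
    have n3 : v i₁ i₁ ≠ v i₁ i₀ := fun h' => by rw [h'] at e11; omega
    have n4 : v i₁ i₁ ≠ v i₀ i₁ := fun h' => by rw [h'] at e11; omega
    have n5 : v i₀ i₀ ≠ v i₁ i₁ := fun h' => by rw [h'] at e00; omega
    have hirr := irreducible_X_mul_X_sub_X_mul_X (K := K) n1 n2 n3 n4 n5
    have t1 := leibnizTerm_one_eq_mul (v := v) hdiag hne
    have tswap := leibnizTerm_swap (v := v) hdiag hne (hnear i₀ i₁ (by omega) (by omega))
      (hnear i₁ i₀ (by omega) (by omega))
    obtain ⟨n', hlow', hn'⟩ := lowest_form_det (c := c) (v := v) (idx := idx) hm hidx hdiag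
      {(i₀ : ℤ) - m, (i₀ : ℤ) + 1 + m} {1, Equiv.swap i₀ i₁}
      (fun π hπ => by
        rw [Finset.mem_insert, Finset.mem_singleton]
        exact eq_one_or_swap_of_moveCost_pair (by exact_mod_cast hm) hi hπ)
      (fun π hπ => by
        rw [Finset.mem_insert, Finset.mem_singleton] at hπ
        rcases hπ with rfl | rfl
        · exact ⟨by rw [hD1]; simp, hcost1 _⟩
        · refine ⟨by rw [tswap]; simp [X_ne_zero], fun i => ?_⟩
          unfold moveCost
          by_cases h0 : i = i₀
          · rw [h0, Equiv.swap_apply_left, hic,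
              show ((m : ℤ) + 1) * ((i₀ : ℤ) + 1) - m * (i₀ : ℤ) = i₀ + 1 + m by ring,
              if_pos (by simp), if_neg (by simp; omega)]
            ring
          by_cases h1 : i = i₁
          · rw [h1, Equiv.swap_apply_right, hic,
              show ((m : ℤ) + 1) * (i₀ : ℤ) - m * ((i₀ : ℤ) + 1) = i₀ - m by ring,
              if_pos (by simp), if_neg (by simp; omega)]
            ring
          · rw [Equiv.swap_apply_of_ne_of_ne h0 h1,
              show ((m : ℤ) + 1) * (i : ℤ) - m * i = i by ring]
            simp)
    have hswap1 : (1 : Equiv.Perm (Fin M)) ≠ Equiv.swap i₀ i₁ := fun h' =>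
      hne (Equiv.swap_eq_refl_iff.1 h'.symm)
    rw [Finset.sum_pair hswap1, t1, tswap, ← sub_eq_add_neg, ← mul_sub] at hn'
    rw [hgh] at hlow' hn'
    set Q : σ →₀ ℕ := ∑ i ∈ Finset.univ \ {i₀, i₁}, single (v i i) 1 with hQ
    have hQ0 : Q (v i₀ i₀) = 0 := by rw [hQ, hDi]; simp
    have hQ1 : Q (v i₁ i₁) = 0 := by rw [hQ, hDi]; simp
    have hQD : Q + single (v i₀ i₀) 1 + single (v i₁ i₁) 1 = D := by
      rw [hDdef, hQ, add_assoc, ← Finset.sum_pair (f := fun i => single (v i i) 1) hne]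
      exact Finset.sum_sdiff (Finset.subset_univ _)
    obtain ⟨k, l, -, -, -, hmul⟩ := exists_lowest_factors
      (by rw [hn']; exact mul_ne_zero (by simp) hirr.ne_zero) hlow'
    rw [hn'] at hmul
    have hle : ∀ {e : σ →₀ ℕ}, e ≤ Q → e (v i₀ i₀) = 0 ∧ e (v i₁ i₁) = 0 := fun he =>
      ⟨Nat.le_zero.1 (hQ0 ▸ he _), Nat.le_zero.1 (hQ1 ▸ he _)⟩
    rcases hirr.prime.dvd_or_dvd (Dvd.intro_left _ hmul.symm) with hdv | hdv
    · right
      obtain ⟨a', ha', b', hb', hab', hbQ⟩ :=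
        exists_exponents_of_dvd_lowest n1 n2 hmul hdv hirr.ne_zero
      rw [← (huniq a' ha' b' hb' (by rw [hab', hQD])).2]
      exact hle hbQ
    · left
      obtain ⟨b', hb', a', ha', hab', haQ⟩ :=
        exists_exponents_of_dvd_lowest n1 n2 ((mul_comm _ _).trans hmul) hdv hirr.ne_zero
      rw [← (huniq a' ha' b' hb' (by rw [add_comm, hab', hQD])).1]
      exact hle haQ
  have hsum : ∀ i, a (v i i) + b (v i i) = 1 := by
    intro i
    rw [← Finsupp.add_apply, hab, hDdef, hDi]; simp
  have hall : ∀ j (hj : j < M),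
      (a (v ⟨j, hj⟩ ⟨j, hj⟩) = 0 ↔ a (v ⟨0, hM⟩ ⟨0, hM⟩) = 0) := by
    intro j
    induction j with
    | zero => intro _; rfl
    | succ j ih =>
      intro hj
      have h1 := ih (by omega)
      have h2 := hstep ⟨j, by omega⟩ ⟨j + 1, hj⟩ rfl
      have h3 := hsum ⟨j, by omega⟩
      have h4 := hsum ⟨j + 1, hj⟩
      omega
  have hzero : ∀ e : σ →₀ ℕ, e ≤ D → (∀ i, e (v i i) = 0) → e = 0 := by
    intro e he h0
    ext τ
    by_cases hτ : ∃ i, v i i = τ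
    · obtain ⟨i, rfl⟩ := hτ
      exact h0 i
    · have h1 : D τ = 0 := by
        rw [hDdef, Finsupp.finsetSum_apply]
        exact Finset.sum_eq_zero fun i _ =>
          Finsupp.single_eq_of_ne fun h' => hτ ⟨i, h'.symm⟩
      exact Nat.le_zero.1 (h1 ▸ he τ)
  by_cases h0 : a (v ⟨0, hM⟩ ⟨0, hM⟩) = 0
  · left
    have ha0 : a = 0 := hzero a (hab ▸ le_self_add) fun i => (hall i i.2).2 h0
    rw [ha0, zero_add] at hab
    rw [hab] at hb
    exact isUnit_of_full_degree (by rwa [mul_comm]) hb (by rwa [mul_comm])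
  · right
    have hb0 : b = 0 := hzero b (hab ▸ le_add_self) fun i => by
      have h1 := (hall i i.2).not.2 h0
      have h2 := hsum i
      change a (v i i) ≠ 0 at h1
      omega
    rw [hb0, add_zero] at hab
    rw [hab] at ha
    exact isUnit_of_full_degree hf0 ha htot

end Determinant

end LowestForms

section Core

/-- The coefficient, `0` or `1`, of the entry `(p, q)` of the core of the generic pair of
matrices of size `m + 1`. -/
def coreCoeff (m p q : ℕ) : ℂ :=
  if q / (m + 1) = p / m ∨ q / (m + 1) + 1 = p / m then 1 else 0

/-- The variable at the entry `(p, q)` of the core of the generic pair of matrices of size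
`m + 1`, when this entry is nonzero. -/
def coreVar (m p q : ℕ) : Bool × ℕ × ℕ :=
  (decide (q / (m + 1) ≠ p / m), p % m + 1, q % (m + 1))

/-- The index of a variable: the variable at the entry `(p, q)` of the core has index
`(m + 1) * p - m * q`. -/
def coreIndex (m : ℕ) (τ : Bool × ℕ × ℕ) : ℤ :=
  (m + 1) * ((τ.2.1 : ℤ) - 1) - m * τ.2.2 + if τ.1 then (m : ℤ) * (m + 1) else 0

lemma stairCore_gen_apply {m : ℕ} (hm : 1 ≤ m) {p q : ℕ} (hp : p < m * (m + 1))
    (hq : q < m * (m + 1)) :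
    stairCore (m + 1) (m + 1) (genX (m + 1) (m + 1) 0) (genY (m + 1) (m + 1) 0) p q =
      MvPolynomial.C (coreCoeff m p q) * MvPolynomial.X (coreVar m p q) := by
  have hr := Nat.mod_lt p (show 0 < m by omega)
  have hc := Nat.mod_lt q (show 0 < m + 1 by omega)
  have hp' := Nat.div_add_mod p m
  have hq' := Nat.div_add_mod q (m + 1)
  have hpm : p / m < m + 1 := Nat.div_lt_of_lt_mul hp
  have hqm : q / (m + 1) < m := Nat.div_lt_of_lt_mul (by rwa [mul_comm])
  have hpdiv : p < m * m ↔ p / m < m := by rw [Nat.div_lt_iff_lt_mul (by omega)]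
  have hblock : ∀ a : ℕ, (a * (m + 1) ≤ q ∧ q < a * (m + 1) + (m + 1)) ↔ q / (m + 1) = a := by
    intro a
    rw [Nat.div_eq_iff (by omega)]
    omega
  have hoff : ∀ a : ℕ, q / (m + 1) = a → q - a * (m + 1) = q % (m + 1) := by
    rintro a rfl
    rw [mul_comm]; omega
  unfold stairCore coreCoeff coreVar genX genY
  simp only [Nat.add_sub_cancel, hpdiv, hblock]
  by_cases h1 : q / (m + 1) = p / m
  · rw [if_pos (by omega), if_pos h1, hoff _ h1, if_pos (by omega), if_pos (Or.inl h1)]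
    simp [h1]
  by_cases h2 : q / (m + 1) + 1 = p / m
  · have h3 : q / (m + 1) = p / m - 1 := Nat.eq_sub_of_add_eq h2
    have hsucc : ((p / m - 1) * (m + 1) + (m + 1)) = p / m * (m + 1) := by
      rw [← Nat.succ_mul]; congr 1; omega
    have hb := (hblock _).2 h3
    rw [if_pos (Or.inr h2)]
    by_cases h4 : p / m < m
    · rw [if_pos h4, if_neg h1, if_pos ⟨by omega, hb.1, by omega⟩, hoff _ h3,
        if_pos (by omega)]
      simp [h1]
    · have h5 : p / m = m := by omega
      rw [h5] at hb hsucc h3 hp'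
      rw [if_neg h4, show m + 1 - 2 = m - 1 by omega, if_pos ⟨hb.1, by omega⟩, hoff _ h3,
        show p - m * m = p % m by omega, if_pos (by omega)]
      simp [h1]
  · rw [if_neg (by tauto : ¬ (q / (m + 1) = p / m ∨ q / (m + 1) + 1 = p / m)), map_zero, zero_mul]
    by_cases h4 : p / m < m
    · rw [if_pos h4, if_neg h1, if_neg]
      rintro ⟨h5, h6, h7⟩
      have hsucc : ((p / m - 1) * (m + 1) + (m + 1)) = p / m * (m + 1) := by
        rw [← Nat.succ_mul]; congr 1; omega
      have := (hblock (p / m - 1)).1 ⟨h6, by omega⟩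
      omega
    · have h5 : p / m = m := by omega
      rw [if_neg h4, show m + 1 - 2 = m - 1 by omega, if_neg, if_neg (by omega)]
      rintro ⟨h6, h7⟩
      have hsucc : ((m - 1) * (m + 1) + (m + 1)) = m * (m + 1) := by
        rw [← Nat.succ_mul]; congr 1; omega
      have := (hblock (m - 1)).1 ⟨h6, by omega⟩
      omega

lemma coreIndex_coreVar {m p q : ℕ} (h : coreCoeff m p q ≠ 0) :
    coreIndex m (coreVar m p q) = (m + 1) * (p : ℤ) - m * (q : ℤ) := by
  have hp : (m : ℤ) * ((p / m : ℕ) : ℤ) + ((p % m : ℕ) : ℤ) = p := by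
    exact_mod_cast Nat.div_add_mod p m
  have hq : ((m : ℤ) + 1) * ((q / (m + 1) : ℕ) : ℤ) + ((q % (m + 1) : ℕ) : ℤ) = q := by
    exact_mod_cast Nat.div_add_mod q (m + 1)
  unfold coreIndex coreVar
  rw [← hp, ← hq]
  by_cases h1 : q / (m + 1) = p / m
  · simp only [h1, ne_eq, not_true_eq_false, decide_false]
    push_cast
    ring
  · have h2 : q / (m + 1) + 1 = p / m := by
      by_contra h2
      exact h (if_neg (by tauto))
    have h3 : ((p / m : ℕ) : ℤ) = ((q / (m + 1) : ℕ) : ℤ) + 1 := by exact_mod_cast h2.symm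
    simp only [ne_eq, h1, not_false_eq_true, decide_true, if_true]
    rw [h3]
    push_cast
    ring

lemma coreCoeff_eq_one {m p q : ℕ} (hm : 1 ≤ m) (hp : p < m * (m + 1)) (h1 : p ≤ q + 1)
    (h2 : q ≤ p + 1) : coreCoeff m p q = 1 := by
  have hr := Nat.mod_lt p (show 0 < m by omega)
  have hc := Nat.mod_lt q (show 0 < m + 1 by omega)
  have hp' := Nat.div_add_mod p m
  have hq' := Nat.div_add_mod q (m + 1)
  have hpm : p / m < m + 1 := Nat.div_lt_of_lt_mul hp
  apply if_pos
  generalize p / m = a at *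
  generalize q / (m + 1) = b at *
  by_contra hab
  rcases (by omega : a + 1 ≤ b ∨ b + 2 ≤ a) with h | h
  · have h3 := Nat.mul_le_mul_left (m + 1) h
    rw [show (m + 1) * (a + 1) = m * a + a + m + 1 by ring] at h3
    omega
  · have h3 := Nat.mul_le_mul_left (m + 1) h
    rw [show (m + 1) * (b + 2) = (m + 1) * b + 2 * m + 2 by ring,
      show (m + 1) * a = m * a + a by ring] at h3
    omega

end Core

/-- for the pair of generic `n × n` matrices (`a = n`, `b = 0`), the trailing
minors `φ_i`, `1 ≤ i ≤ N - n + 1`, of the core are irreducible. -/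
theorem statement10 (n : ℕ) (hn : 2 ≤ n) :
    ∀ i : ℕ, 1 ≤ i → i ≤ (n - 1) * n - n + 1 →
      Irreducible (sminor (stairCore n n (genX n n 0) (genY n n 0)) i ((n - 1) * n)) := by
  intro i hi hiN
  obtain ⟨m, rfl⟩ : ∃ m, n = m + 1 := ⟨n - 1, by omega⟩
  have hm : 1 ≤ m := by omega
  rw [Nat.add_sub_cancel] at hiN ⊢
  have hN : m + 1 ≤ m * (m + 1) := Nat.le_mul_of_pos_left _ hm
  have hentries : (Matrix.of fun r c : Fin (m * (m + 1) + 1 - i) =>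
      stairCore (m + 1) (m + 1) (genX (m + 1) (m + 1) 0) (genY (m + 1) (m + 1) 0)
        (i - 1 + (r : ℕ)) (i - 1 + (c : ℕ))) =
      Matrix.of fun r c : Fin (m * (m + 1) + 1 - i) =>
        MvPolynomial.C (coreCoeff m (i - 1 + (r : ℕ)) (i - 1 + (c : ℕ))) *
          MvPolynomial.X (coreVar m (i - 1 + (r : ℕ)) (i - 1 + (c : ℕ))) := by
    ext1 r c
    exact stairCore_gen_apply hm (by omega) (by omega)
  rw [sminor, hentries]
  refine irreducible_det_of_index (m := m) (idx := fun τ => coreIndex m τ - ((i - 1 : ℕ) : ℤ)) hm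
    (by omega) (fun p q h => ?_) (fun p q h1 h2 => coreCoeff_eq_one hm (by omega) (by omega)
      (by omega))
  rw [coreIndex_coreVar h]
  push_cast
  ring

end
end
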